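/- arXiv:2202.04923 — 2 statements merged into one kernel-verified Lean document; each statement's English description precedes it below -/
import Mathlib

section
/- Let I ⊆ ℚ[x,y,z] be the ideal generated by the four polynomials 4x³y − 4xy³ − 3x²yz − 3y³z − 2xyz² + 2yz³, 32y⁵ + 88xy³z + 33x²yz² − 55y³z² − 66xyz³ + 22yz⁴, 32x²y³ + 72xy³z + 11x²yz² + 35y³z² − 22xyz³ − 22yz⁴, and 2x⁵ − 10xy⁴ − 8x⁴z − 15x²y²z − 7y⁴z + 4x³z² + 2xy²z² + 10x²z³ + 8y²z³ − 4xz⁴ − 2z⁵ (the radical ideal of the triple intersection points of the Böröczky arrangement of 11 lines). Then the saturation of I³ with respect to the irrelevant ideal ⟨x,y,z⟩ is contained in I²; that is, every polynomial F such that F·⟨x,y,z⟩^k ⊆ I³ for some k ≥ 0 belongs to I². In other words, I^{(3)} ⊆ I². -/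
noncomputable def x : MvPolynomial (Fin 3) ℚ := MvPolynomial.X 0
noncomputable def y : MvPolynomial (Fin 3) ℚ := MvPolynomial.X 1
noncomputable def z : MvPolynomial (Fin 3) ℚ := MvPolynomial.X 2

/-- The radical ideal of the triple intersection points of the Böröczky arrangement of
`11` lines. -/
noncomputable def I₁₁ : Ideal (MvPolynomial (Fin 3) ℚ) :=
  Ideal.span
    {4*x^3*y - 4*x*y^3 - 3*x^2*y*z - 3*y^3*z - 2*x*y*z^2 + 2*y*z^3,
     32*y^5 + 88*x*y^3*z + 33*x^2*y*z^2 - 55*y^3*z^2 - 66*x*y*z^3 + 22*y*z^4,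
     32*x^2*y^3 + 72*x*y^3*z + 11*x^2*y*z^2 + 35*y^3*z^2 - 22*x*y*z^3 - 22*y*z^4,
     2*x^5 - 10*x*y^4 - 8*x^4*z - 15*x^2*y^2*z - 7*y^4*z + 4*x^3*z^2 + 2*x*y^2*z^2
       + 10*x^2*z^3 + 8*y^2*z^3 - 4*x*z^4 - 2*z^5}

namespace Boroczky

open MvPolynomial

section Generators

variable {A B : Type*} [CommRing A] [CommRing B]

/-- The first generator of `I₁₁`, as a polynomial expression over an arbitrary ring. -/
def g₀ (a b c : A) : A :=
  4*a^3*b - 4*a*b^3 - 3*a^2*b*c - 3*b^3*c - 2*a*b*c^2 + 2*b*c^3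

/-- The second generator of `I₁₁`. -/
def g₁ (a b c : A) : A :=
  32*b^5 + 88*a*b^3*c + 33*a^2*b*c^2 - 55*b^3*c^2 - 66*a*b*c^3 + 22*b*c^4

/-- The third generator of `I₁₁`. -/
def g₂ (a b c : A) : A :=
  32*a^2*b^3 + 72*a*b^3*c + 11*a^2*b*c^2 + 35*b^3*c^2 - 22*a*b*c^3 - 22*b*c^4

/-- The fourth generator of `I₁₁`. -/
def g₃ (a b c : A) : A :=
  2*a^5 - 10*a*b^4 - 8*a^4*c - 15*a^2*b^2*c - 7*b^4*c + 4*a^3*c^2 + 2*a*b^2*c^2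
    + 10*a^2*c^3 + 8*b^2*c^3 - 4*a*c^4 - 2*c^5

lemma map_g₀ (φ : A →+* B) (a b c : A) : φ (g₀ a b c) = g₀ (φ a) (φ b) (φ c) := by
  simp only [g₀, map_add, map_sub, map_mul, map_pow]
  simp only [map_ofNat]

lemma map_g₁ (φ : A →+* B) (a b c : A) : φ (g₁ a b c) = g₁ (φ a) (φ b) (φ c) := by
  simp only [g₁, map_add, map_sub, map_mul, map_pow]
  simp only [map_ofNat]

lemma map_g₂ (φ : A →+* B) (a b c : A) : φ (g₂ a b c) = g₂ (φ a) (φ b) (φ c) := by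
  simp only [g₂, map_add, map_sub, map_mul, map_pow]
  simp only [map_ofNat]

lemma map_g₃ (φ : A →+* B) (a b c : A) : φ (g₃ a b c) = g₃ (φ a) (φ b) (φ c) := by
  simp only [g₃, map_add, map_sub, map_mul, map_pow]
  simp only [map_ofNat]

end Generators

lemma I₁₁_eq_span :
    I₁₁ = Ideal.span {g₀ x y z, g₁ x y z, g₂ x y z, g₃ x y z} := rfl

lemma gens_mem :
    g₀ x y z ∈ I₁₁ ∧ g₁ x y z ∈ I₁₁ ∧ g₂ x y z ∈ I₁₁ ∧ g₃ x y z ∈ I₁₁ := by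
  rw [I₁₁_eq_span]
  refine ⟨?_, ?_, ?_, ?_⟩ <;> exact Ideal.subset_span (by simp)

lemma map_mem_of_mem_I₁₁ {B : Type*} [CommRing B] (φ : MvPolynomial (Fin 3) ℚ →+* B)
    {J : Ideal B} (h₀ : g₀ (φ x) (φ y) (φ z) ∈ J) (h₁ : g₁ (φ x) (φ y) (φ z) ∈ J)
    (h₂ : g₂ (φ x) (φ y) (φ z) ∈ J) (h₃ : g₃ (φ x) (φ y) (φ z) ∈ J) :
    I₁₁.map φ ≤ J := by
  rw [I₁₁_eq_span, Ideal.map_span, Ideal.span_le]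
  rintro _ ⟨p, hp, rfl⟩
  simp only [Set.mem_insert_iff, Set.mem_singleton_iff] at hp
  rcases hp with rfl | rfl | rfl | rfl
  · rwa [map_g₀]
  · rwa [map_g₁]
  · rwa [map_g₂]
  · rwa [map_g₃]

section Homogeneous

attribute [local instance] MvPolynomial.gradedAlgebra

lemma isHomogeneous_term (n : ℚ) (a b c : ℕ) :
    (C n * x ^ a * y ^ b * z ^ c).IsHomogeneous (a + b + c) := by
  have h := (((isHomogeneous_C (Fin 3) n).mul ((isHomogeneous_X ℚ (0 : Fin 3)).pow a)).mul
    ((isHomogeneous_X ℚ (1 : Fin 3)).pow b)).mul ((isHomogeneous_X ℚ (2 : Fin 3)).pow c)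
  simpa [x, y, z, add_assoc] using h

lemma isHomogeneous_g₀ : (g₀ x y z).IsHomogeneous 4 := by
  have e : g₀ x y z = C 4 * x ^ 3 * y ^ 1 * z ^ 0 + C (-4) * x ^ 1 * y ^ 3 * z ^ 0
      + C (-3) * x ^ 2 * y ^ 1 * z ^ 1 + C (-3) * x ^ 0 * y ^ 3 * z ^ 1
      + C (-2) * x ^ 1 * y ^ 1 * z ^ 2 + C 2 * x ^ 0 * y ^ 1 * z ^ 3 := by
    simp only [g₀, map_neg, map_ofNat]; ring
  rw [e]
  repeat' apply IsHomogeneous.add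
  all_goals exact isHomogeneous_term _ _ _ _

lemma isHomogeneous_g₁ : (g₁ x y z).IsHomogeneous 5 := by
  have e : g₁ x y z = C 32 * x ^ 0 * y ^ 5 * z ^ 0 + C 88 * x ^ 1 * y ^ 3 * z ^ 1
      + C 33 * x ^ 2 * y ^ 1 * z ^ 2 + C (-55) * x ^ 0 * y ^ 3 * z ^ 2
      + C (-66) * x ^ 1 * y ^ 1 * z ^ 3 + C 22 * x ^ 0 * y ^ 1 * z ^ 4 := by
    simp only [g₁, map_neg, map_ofNat]; ring
  rw [e]
  repeat' apply IsHomogeneous.add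
  all_goals exact isHomogeneous_term _ _ _ _

lemma isHomogeneous_g₂ : (g₂ x y z).IsHomogeneous 5 := by
  have e : g₂ x y z = C 32 * x ^ 2 * y ^ 3 * z ^ 0 + C 72 * x ^ 1 * y ^ 3 * z ^ 1
      + C 11 * x ^ 2 * y ^ 1 * z ^ 2 + C 35 * x ^ 0 * y ^ 3 * z ^ 2
      + C (-22) * x ^ 1 * y ^ 1 * z ^ 3 + C (-22) * x ^ 0 * y ^ 1 * z ^ 4 := by
    simp only [g₂, map_neg, map_ofNat]; ring
  rw [e]
  repeat' apply IsHomogeneous.add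
  all_goals exact isHomogeneous_term _ _ _ _

lemma isHomogeneous_g₃ : (g₃ x y z).IsHomogeneous 5 := by
  have e : g₃ x y z = C 2 * x ^ 5 * y ^ 0 * z ^ 0 + C (-10) * x ^ 1 * y ^ 4 * z ^ 0
      + C (-8) * x ^ 4 * y ^ 0 * z ^ 1 + C (-15) * x ^ 2 * y ^ 2 * z ^ 1
      + C (-7) * x ^ 0 * y ^ 4 * z ^ 1 + C 4 * x ^ 3 * y ^ 0 * z ^ 2
      + C 2 * x ^ 1 * y ^ 2 * z ^ 2 + C 10 * x ^ 2 * y ^ 0 * z ^ 3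
      + C 8 * x ^ 0 * y ^ 2 * z ^ 3 + C (-4) * x ^ 1 * y ^ 0 * z ^ 4
      + C (-2) * x ^ 0 * y ^ 0 * z ^ 5 := by
    simp only [g₃, map_neg, map_ofNat]; ring
  rw [e]
  repeat' apply IsHomogeneous.add
  all_goals exact isHomogeneous_term _ _ _ _

lemma I₁₁_isHomogeneous : I₁₁.IsHomogeneous (homogeneousSubmodule (Fin 3) ℚ) := by
  rw [I₁₁_eq_span]
  refine Ideal.homogeneous_span _ _ fun p hp ↦ ?_
  simp only [Set.mem_insert_iff, Set.mem_singleton_iff] at hp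
  rcases hp with rfl | rfl | rfl | rfl
  · exact ⟨4, isHomogeneous_g₀⟩
  · exact ⟨5, isHomogeneous_g₁⟩
  · exact ⟨5, isHomogeneous_g₂⟩
  · exact ⟨5, isHomogeneous_g₃⟩

lemma I₁₁_pow_isHomogeneous (n : ℕ) :
    (I₁₁ ^ n).IsHomogeneous (homogeneousSubmodule (Fin 3) ℚ) := by
  induction n with
  | zero => simpa using Ideal.IsHomogeneous.top _
  | succ n ih => rw [pow_succ]; exact ih.mul I₁₁_isHomogeneous

lemma homogeneousComponent_mul_z_pow (F : MvPolynomial (Fin 3) ℚ) (k n : ℕ) :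
    homogeneousComponent (n + k) (F * z ^ k) = homogeneousComponent n F * z ^ k := by
  have hz : z ^ k ∈ homogeneousSubmodule (Fin 3) ℚ k := by
    simpa [z] using (isHomogeneous_X ℚ (2 : Fin 3)).pow k
  have h := DirectSum.coe_decompose_mul_add_of_right_mem
    (homogeneousSubmodule (Fin 3) ℚ) (i := n) (a := F) hz
  have key (φ : MvPolynomial (Fin 3) ℚ) (i : ℕ) :
      ((DirectSum.decompose (homogeneousSubmodule (Fin 3) ℚ) φ) i : MvPolynomial (Fin 3) ℚ) =
        homogeneousComponent i φ := decomposition.decompose'_apply φ i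
  rwa [key, key] at h

lemma homogeneousComponent_mul_z (F : MvPolynomial (Fin 3) ℚ) (n : ℕ) :
    homogeneousComponent (n + 1) (F * z) = homogeneousComponent n F * z := by
  simpa using homogeneousComponent_mul_z_pow F 1 n

/-- It suffices to check the containment on homogeneous elements and for multiplication
by powers of `z`. -/
lemma saturation_le_of_homogeneous
    (H : ∀ (t k : ℕ) (F : MvPolynomial (Fin 3) ℚ), F.IsHomogeneous t →
      F * z ^ k ∈ I₁₁ ^ 3 → F ∈ I₁₁ ^ 2)
    (F : MvPolynomial (Fin 3) ℚ) (k : ℕ)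
    (hF : Ideal.span {F} * (Ideal.span {x, y, z}) ^ k ≤ I₁₁ ^ 3) : F ∈ I₁₁ ^ 2 := by
  have hFz : F * z ^ k ∈ I₁₁ ^ 3 :=
    hF (Ideal.mul_mem_mul (Ideal.mem_span_singleton_self F)
      (Ideal.pow_mem_pow (Ideal.subset_span (by simp)) k))
  rw [mem_iff_homogeneousComponent_mem (I₁₁_pow_isHomogeneous 2)]
  intro t
  refine H t k _ (homogeneousComponent_isHomogeneous t F) ?_
  rw [← homogeneousComponent_mul_z_pow]
  exact homogeneousComponent_mem_of_mem (I₁₁_pow_isHomogeneous 3) hFz _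

end Homogeneous

section Lines

variable {A : Type*} [CommRing A]

/-- The quartic cutting out the four triple points on the line with parameter `e` other than
the axis of symmetry; `w` is a coordinate on the line. -/
def quartic (a w : A) : A :=
  w^4 + (a + 1)*w^3 + (a^2 + a - 4)*w^2 + (a^3 + a^2 - 4*a - 3)*w
    + (a^4 + a^3 - 4*a^2 - 3*a + 3)

lemma g₀_mul_sq_eq_neg_one {J : A} (hJ : J^2 = -1) (a b c : A) :
    g₀ a (J*b) c = J * (
      4*a^3*b + 4*a*b^3 - 3*a^2*b*c + 3*b^3*c - 2*a*b*c^2 + 2*b*c^3) := by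
  unfold g₀
  linear_combination (
    -4*a*b^3*J - 3*b^3*c*J) * hJ

lemma g₀_on_line {J e w : A} (hJ : J^2 = -1)
    (he : 1 + e + e^2 + e^3 + e^4 + e^5 + e^6 + e^7 + e^8 + e^9 + e^10 = 0) :
    g₀ ((e^2 + e^10*w) + (e^9 + e*w)) (J*((e^2 + e^10*w) - (e^9 + e*w))) 2 =
      quartic (e^3 + e^8) w *
        (J * (-8*e^4 + 8*e^7)) := by
  rw [g₀_mul_sq_eq_neg_one hJ]
  unfold quartic
  linear_combination J * (
    16*e^2 - 16*e^3 + 16*e^4 - 16*e^5 - 48*e^7 + 56*e^8 - 24*e^9 + 8*e^10 + 8*e^11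
    - 24*e^12 + 56*e^13 - 32*e^14 - 24*e^15 + 24*e^16 + 48*e^18 - 48*e^19 - 24*e^20
    + 24*e^21 + 32*e^23 - 32*e^24 + 8*e^28 - 8*e^29 - 16*e*w + 16*e^2*w - 24*e^4*w
    + 24*e^6*w - 8*e^7*w + 8*e^8*w + 72*e^10*w - 72*e^11*w - 16*e^12*w + 16*e^13*w
    + 24*e^15*w - 24*e^16*w + 8*e^20*w - 8*e^21*w + 8*e^2*w^2 - 8*e^3*w^2 - 8*e^4*w^2
    + 8*e^5*w^2 + 40*e^7*w^2 - 40*e^8*w^2 + 8*e^12*w^2 - 56*e^13*w^2 + 48*e^14*w^2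
    + 24*e^18*w^2 - 24*e^19*w^2 + 8*e^4*w^3 - 8*e^5*w^3 - 8*e^10*w^3 + 8*e^11*w^3
    - 32*e^21*w^3 + 32*e^22*w^3 - 8*e^7*w^4 + 8*e^8*w^4 - 8*e^18*w^4 + 8*e^19*w^4
    - 8*e^29*w^4 + 8*e^30*w^4) * he

lemma g₁_mul_sq_eq_neg_one {J : A} (hJ : J^2 = -1) (a b c : A) :
    g₁ a (J*b) c = J * (
      32*b^5 - 88*a*b^3*c + 33*a^2*b*c^2 + 55*b^3*c^2 - 66*a*b*c^3 + 22*b*c^4) := by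
  unfold g₁
  linear_combination (
    -32*b^5*J + 32*b^5*J^3 + 88*a*b^3*c*J - 55*b^3*c^2*J) * hJ

lemma g₁_on_line {J e w : A} (hJ : J^2 = -1)
    (he : 1 + e + e^2 + e^3 + e^4 + e^5 + e^6 + e^7 + e^8 + e^9 + e^10 = 0) :
    g₁ ((e^2 + e^10*w) + (e^9 + e*w)) (J*((e^2 + e^10*w) - (e^9 + e*w))) 2 =
      quartic (e^3 + e^8) w *
        (J * (320 + 640*e + 480*e^2 + 128*e^3 + 176*e^4 + 352*e^5 + 288*e^6 + 464*e^7
        + 512*e^8 + 160*e^9 - 320*e*w + 160*e^3*w - 32*e^5*w + 32*e^6*w - 160*e^8*w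
        + 320*e^10*w)) := by
  rw [g₁_mul_sq_eq_neg_one hJ]
  unfold quartic
  linear_combination J * (
    -960 - 960*e + 832*e^2 + 1664*e^3 + 288*e^4 - 480*e^5 + 768*e^6 + 544*e^7 + 528*e^8
    - 80*e^9 + 784*e^10 + 1520*e^11 + 464*e^12 - 592*e^13 - 1600*e^14 - 400*e^15 + 1616*e^16
    - 128*e^17 + 512*e^18 - 1888*e^19 - 1584*e^20 - 208*e^21 - 288*e^22 + 416*e^23
    - 192*e^24 - 1536*e^25 - 288*e^26 - 224*e^27 + 336*e^28 + 48*e^29 - 352*e^30 - 160*e^31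
    + 32*e^34 - 32*e^35 + 960*w + 1568*e*w - 1088*e^2*w - 256*e^3*w + 944*e^4*w + 416*e^5*w
    - 1104*e^6*w - 912*e^7*w + 3600*e^8*w - 768*e^9*w + 368*e^10*w - 1808*e^11*w - 2336*e^12*w
    + 2848*e^13*w - 352*e^14*w - 48*e^15*w + 112*e^16*w - 3488*e^17*w + 2144*e^18*w
    - 1760*e^19*w + 1424*e^20*w + 400*e^21*w - 1216*e^22*w + 352*e^23*w - 960*e^24*w
    + 640*e^25*w + 1760*e^26*w - 1728*e^27*w + 608*e^28*w - 800*e^29*w + 160*e^30*w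
    + 320*e^31*w - 320*e^32*w - 160*e^35*w + 160*e^36*w + 1280*w^2 + 320*e*w^2 + 848*e^2*w^2
    - 1776*e^3*w^2 - 1360*e^4*w^2 + 1520*e^5*w^2 + 608*e^6*w^2 - 80*e^7*w^2 - 752*e^8*w^2
    - 2336*e^9*w^2 + 1888*e^10*w^2 - 1536*e^11*w^2 + 1520*e^12*w^2 - 432*e^13*w^2
    - 96*e^14*w^2 - 256*e^15*w^2 - 960*e^16*w^2 + 960*e^17*w^2 + 1872*e^18*w^2 - 1840*e^19*w^2
    + 832*e^20*w^2 - 1024*e^21*w^2 + 1120*e^22*w^2 - 640*e^23*w^2 - 320*e^24*w^2 + 320*e^25*w^2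
    - 320*e^26*w^2 - 640*e^27*w^2 + 640*e^28*w^2 - 960*e^29*w^2 + 960*e^30*w^2 + 320*e^36*w^2
    - 320*e^37*w^2 - 320*w^3 - 1600*e*w^3 + 1440*e^2*w^3 + 320*e^3*w^3 - 336*e^4*w^3
    - 816*e^5*w^3 + 864*e^6*w^3 - 192*e^7*w^3 - 1152*e^8*w^3 + 832*e^9*w^3 + 1296*e^10*w^3
    - 1264*e^11*w^3 + 512*e^12*w^3 - 704*e^13*w^3 + 1120*e^14*w^3 - 960*e^15*w^3 + 608*e^17*w^3
    - 608*e^18*w^3 - 672*e^19*w^3 + 672*e^20*w^3 - 1216*e^21*w^3 + 1216*e^22*w^3 - 320*e^23*w^3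
    + 320*e^24*w^3 - 320*e^26*w^3 + 320*e^27*w^3 + 608*e^28*w^3 - 608*e^29*w^3 + 640*e^30*w^3
    - 640*e^31*w^3 - 320*e^37*w^3 + 320*e^38*w^3 - 320*w^4 - 160*e^2*w^4 + 192*e^3*w^4
    + 608*e^4*w^4 - 640*e^5*w^4 - 144*e^7*w^4 + 144*e^8*w^4 + 448*e^9*w^4 - 448*e^10*w^4
    - 960*e^13*w^4 + 960*e^14*w^4 + 160*e^16*w^4 - 160*e^17*w^4 - 464*e^18*w^4 + 464*e^19*w^4
    + 448*e^20*w^4 - 448*e^21*w^4 + 640*e^22*w^4 - 640*e^23*w^4 + 160*e^27*w^4 - 160*e^28*w^4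
    - 464*e^29*w^4 + 464*e^30*w^4 - 160*e^31*w^4 + 160*e^32*w^4 + 160*e^38*w^4 - 160*e^39*w^4
    + 320*e*w^5 - 320*e^2*w^5 - 160*e^3*w^5 + 160*e^4*w^5 - 32*e^6*w^5 + 32*e^7*w^5
    + 160*e^8*w^5 - 160*e^9*w^5 - 320*e^10*w^5 + 320*e^11*w^5 + 320*e^12*w^5 - 320*e^13*w^5
    - 32*e^17*w^5 + 32*e^18*w^5 + 160*e^19*w^5 - 160*e^20*w^5 - 320*e^21*w^5 + 320*e^22*w^5
    - 32*e^28*w^5 + 32*e^29*w^5 + 160*e^30*w^5 - 160*e^31*w^5 - 32*e^39*w^5 + 32*e^40*w^5) * he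

lemma g₂_mul_sq_eq_neg_one {J : A} (hJ : J^2 = -1) (a b c : A) :
    g₂ a (J*b) c = J * (
      -32*a^2*b^3 - 72*a*b^3*c + 11*a^2*b*c^2 - 35*b^3*c^2 - 22*a*b*c^3 - 22*b*c^4) := by
  unfold g₂
  linear_combination (
    32*a^2*b^3*J + 72*a*b^3*c*J + 35*b^3*c^2*J) * hJ

lemma g₂_on_line {J e w : A} (hJ : J^2 = -1)
    (he : 1 + e + e^2 + e^3 + e^4 + e^5 + e^6 + e^7 + e^8 + e^9 + e^10 = 0) :
    g₂ ((e^2 + e^10*w) + (e^9 + e*w)) (J*((e^2 + e^10*w) - (e^9 + e*w))) 2 =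
      quartic (e^3 + e^8) w *
        (J * (32 + 96*e + 96*e^3 + 112*e^4 + 64*e^6 - 48*e^7 - 32*e^8 + 64*e^9 - 32*e^10
        - 64*e*w - 32*e^3*w + 32*e^5*w - 32*e^6*w + 32*e^8*w + 64*e^10*w)) := by
  rw [g₂_mul_sq_eq_neg_one hJ]
  unfold quartic
  linear_combination J * (
    -96 - 192*e - 64*e^2 + 160*e^3 - 32*e^4 + 224*e^5 + 128*e^6 + 736*e^7 - 816*e^8
    + 944*e^9 - 720*e^10 + 80*e^11 + 784*e^12 - 1520*e^13 + 928*e^14 + 80*e^15 - 784*e^16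
    + 1024*e^17 - 1152*e^18 + 448*e^19 + 496*e^20 - 1008*e^21 + 608*e^22 - 672*e^23
    + 224*e^24 + 256*e^25 - 352*e^26 + 224*e^27 - 144*e^28 + 16*e^29 + 96*e^30 - 96*e^31
    + 32*e^32 - 32*e^34 + 32*e^35 + 96*w + 736*e*w - 832*e^2*w + 512*e^3*w + 16*e^4*w
    - 160*e^5*w + 176*e^6*w - 304*e^7*w - 208*e^8*w + 288*e^9*w - 944*e^10*w + 1040*e^11*w
    - 1120*e^12*w + 864*e^13*w - 192*e^14*w - 16*e^15*w + 496*e^16*w - 608*e^17*w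
    + 288*e^18*w + 64*e^19*w - 208*e^20*w + 304*e^21*w - 448*e^22*w + 160*e^23*w + 96*e^24*w
    - 128*e^25*w + 416*e^26*w - 448*e^27*w + 160*e^28*w - 96*e^29*w - 32*e^30*w + 64*e^31*w
    - 64*e^32*w + 32*e^35*w - 32*e^36*w + 128*w^2 + 64*e*w^2 - 16*e^2*w^2 + 80*e^3*w^2
    - 624*e^4*w^2 + 464*e^5*w^2 - 192*e^6*w^2 - 240*e^7*w^2 + 464*e^8*w^2 - 480*e^9*w^2
    + 416*e^10*w^2 + 192*e^11*w^2 - 304*e^12*w^2 + 752*e^13*w^2 - 800*e^14*w^2 + 384*e^15*w^2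
    - 160*e^16*w^2 - 192*e^17*w^2 + 112*e^18*w^2 - 144*e^19*w^2 - 448*e^20*w^2 + 512*e^21*w^2
    - 224*e^22*w^2 + 256*e^23*w^2 - 64*e^24*w^2 + 64*e^25*w^2 - 64*e^26*w^2 + 128*e^27*w^2
    - 128*e^28*w^2 - 192*e^29*w^2 + 192*e^30*w^2 + 64*e^36*w^2 - 64*e^37*w^2 - 32*w^3
    - 320*e*w^3 + 352*e^2*w^3 - 160*e^3*w^3 + 16*e^4*w^3 - 16*e^5*w^3 - 96*e^6*w^3
    + 192*e^7*w^3 + 160*e^8*w^3 - 192*e^9*w^3 + 432*e^10*w^3 - 464*e^11*w^3 - 128*e^12*w^3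
    + 192*e^13*w^3 - 224*e^14*w^3 + 192*e^15*w^3 - 96*e^17*w^3 + 96*e^18*w^3 + 160*e^19*w^3
    - 160*e^20*w^3 + 192*e^21*w^3 - 192*e^22*w^3 + 320*e^23*w^3 - 320*e^24*w^3 - 64*e^26*w^3
    + 64*e^27*w^3 - 96*e^28*w^3 + 96*e^29*w^3 - 128*e^30*w^3 + 128*e^31*w^3 - 64*e^37*w^3
    + 64*e^38*w^3 - 32*w^4 + 32*e^2*w^4 - 64*e^3*w^4 + 160*e^4*w^4 - 128*e^5*w^4 + 80*e^7*w^4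
    - 80*e^8*w^4 + 64*e^9*w^4 - 64*e^10*w^4 - 192*e^13*w^4 + 192*e^14*w^4 - 32*e^16*w^4
    + 32*e^17*w^4 + 16*e^18*w^4 - 16*e^19*w^4 + 64*e^20*w^4 - 64*e^21*w^4 - 128*e^22*w^4
    + 128*e^23*w^4 - 32*e^27*w^4 + 32*e^28*w^4 + 16*e^29*w^4 - 16*e^30*w^4 + 160*e^31*w^4
    - 160*e^32*w^4 - 32*e^38*w^4 + 32*e^39*w^4 + 64*e*w^5 - 64*e^2*w^5 + 32*e^3*w^5
    - 32*e^4*w^5 + 32*e^6*w^5 - 32*e^7*w^5 - 32*e^8*w^5 + 32*e^9*w^5 - 64*e^10*w^5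
    + 64*e^11*w^5 + 64*e^12*w^5 - 64*e^13*w^5 + 32*e^17*w^5 - 32*e^18*w^5 - 32*e^19*w^5
    + 32*e^20*w^5 - 64*e^21*w^5 + 64*e^22*w^5 + 32*e^28*w^5 - 32*e^29*w^5 - 32*e^30*w^5
    + 32*e^31*w^5 + 32*e^39*w^5 - 32*e^40*w^5) * he

lemma g₃_mul_sq_eq_neg_one {J : A} (hJ : J^2 = -1) (a b c : A) :
    g₃ a (J*b) c = (
      2*a^5 - 10*a*b^4 - 8*a^4*c + 15*a^2*b^2*c - 7*b^4*c + 4*a^3*c^2 - 2*a*b^2*c^2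
      + 10*a^2*c^3 - 8*b^2*c^3 - 4*a*c^4 - 2*c^5) := by
  unfold g₃
  linear_combination (
    10*a*b^4 - 10*a*b^4*J^2 - 15*a^2*b^2*c + 7*b^4*c - 7*b^4*c*J^2 + 2*a*b^2*c^2 + 8*b^2*c^3) *
    hJ

lemma g₃_on_line {J e w : A} (hJ : J^2 = -1)
    (he : 1 + e + e^2 + e^3 + e^4 + e^5 + e^6 + e^7 + e^8 + e^9 + e^10 = 0) :
    g₃ ((e^2 + e^10*w) + (e^9 + e*w)) (J*((e^2 + e^10*w) - (e^9 + e*w))) 2 =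
      quartic (e^3 + e^8) w *
        (-40*e^2 - 32*e^3 + 8*e^5 + 8*e^6 - 32*e^8 - 40*e^9 + 40*e^3*w - 8*e^5*w - 8*e^6*w
        + 40*e^8*w) := by
  rw [g₃_mul_sq_eq_neg_one hJ]
  unfold quartic
  linear_combination (
    -64 + 64*e + 56*e^2 + 40*e^3 - 80*e^4 - 160*e^5 + 32*e^6 + 112*e^7 - 40*e^8 - 8*e^9
    - 80*e^10 + 232*e^11 - 160*e^12 - 128*e^13 - 48*e^14 + 104*e^15 + 72*e^16 + 48*e^17
    - 104*e^18 - 176*e^19 + 112*e^20 + 240*e^21 - 8*e^22 - 24*e^23 - 128*e^24 + 168*e^26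
    - 40*e^27 + 32*e^28 - 32*e^29 - 8*e^30 + 40*e^31 + 8*e^34 - 8*e^35 - 64*e*w - 56*e^2*w
    + 192*e^3*w - 72*e^4*w - 56*e^5*w + 96*e^6*w - 48*e^7*w - 160*e^8*w + 288*e^9*w
    - 312*e^10*w + 176*e^11*w - 112*e^12*w + 96*e^13*w + 232*e^14*w - 200*e^15*w - 24*e^16*w
    - 200*e^17*w + 264*e^18*w + 680*e^19*w - 720*e^20*w - 24*e^21*w - 48*e^22*w + 72*e^23*w
    + 160*e^24*w - 160*e^25*w + 40*e^26*w - 48*e^27*w + 8*e^28*w + 40*e^29*w - 40*e^30*w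
    - 40*e^35*w + 40*e^36*w - 144*e^2*w^2 + 136*e^3*w^2 + 64*e^4*w^2 - 8*e^5*w^2 - 88*e^6*w^2
    + 40*e^7*w^2 - 8*e^8*w^2 - 200*e^9*w^2 + 248*e^10*w^2 + 656*e^11*w^2 - 696*e^12*w^2
    - 16*e^13*w^2 - 48*e^14*w^2 + 144*e^15*w^2 + 160*e^16*w^2 - 240*e^17*w^2 + 40*e^18*w^2
    - 48*e^19*w^2 + 32*e^20*w^2 + 16*e^21*w^2 - 280*e^22*w^2 + 240*e^23*w^2 + 80*e^27*w^2
    - 80*e^28*w^2 + 40*e^2*w^3 + 160*e^3*w^3 - 200*e^4*w^3 - 8*e^5*w^3 - 40*e^6*w^3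
    + 48*e^7*w^3 + 192*e^8*w^3 - 192*e^9*w^3 + 40*e^10*w^3 - 48*e^11*w^3 + 112*e^12*w^3
    - 64*e^13*w^3 - 280*e^14*w^3 + 240*e^15*w^3 + 8*e^17*w^3 - 8*e^18*w^3 + 72*e^19*w^3
    - 72*e^20*w^3 + 80*e^23*w^3 - 80*e^24*w^3 + 8*e^28*w^3 - 8*e^29*w^3 - 160*e^30*w^3
    + 160*e^31*w^3 + 40*e^2*w^4 - 48*e^3*w^4 + 8*e^4*w^4 + 48*e^9*w^4 - 48*e^10*w^4
    - 80*e^11*w^4 + 80*e^12*w^4 - 40*e^16*w^4 + 40*e^17*w^4 + 48*e^20*w^4 - 48*e^21*w^4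
    - 160*e^22*w^4 + 160*e^23*w^4 - 40*e^27*w^4 + 40*e^28*w^4 + 40*e^31*w^4 - 40*e^32*w^4
    - 40*e^38*w^4 + 40*e^39*w^4 - 40*e^3*w^5 + 40*e^4*w^5 + 8*e^6*w^5 - 8*e^7*w^5
    - 40*e^8*w^5 + 40*e^9*w^5 + 8*e^17*w^5 - 8*e^18*w^5 - 40*e^19*w^5 + 40*e^20*w^5
    + 8*e^28*w^5 - 8*e^29*w^5 - 40*e^30*w^5 + 40*e^31*w^5 + 8*e^39*w^5 - 8*e^40*w^5) * he

end Lines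

lemma map_mem_pow {A B : Type*} [CommRing A] [CommRing B] {I : Ideal A} {J : Ideal B}
    (φ : A →+* B) (h : I.map φ ≤ J) {n : ℕ} {a : A} (ha : a ∈ I ^ n) : φ a ∈ J ^ n := by
  have h1 := Ideal.mem_map_of_mem φ ha
  rw [Ideal.map_pow] at h1
  exact Ideal.pow_right_mono h n h1

lemma natDegree_aeval_le {A : Type*} [CommRing A] [Algebra ℚ A] {m : ℕ}
    {F : MvPolynomial (Fin 3) ℚ} (hF : F.IsHomogeneous m) (f : Fin 3 → Polynomial A)
    (hf : ∀ i, (f i).natDegree ≤ 1) : (aeval f F).natDegree ≤ m := by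
  rw [← aeval_map_algebraMap A]
  simpa using aeval_natDegree_le _ (hF.map _).totalDegree_le f hf

section Bezout

open Polynomial in
/-- The equation, in the coordinates `u = x + iy`, `v = x - iy`, of the line with parameter `ζ`. -/
noncomputable def lineRoot (ζ : ℂ) : ℂ[X] :=
  Polynomial.C (ζ ^ 9) * Polynomial.X + Polynomial.C (ζ ^ 2 - ζ ^ 7)

/-- Restriction of forms in `x, y, z` to the line with parameter `ζ`. -/
noncomputable def restrictLine (ζ : ℂ) : MvPolynomial (Fin 3) ℚ →ₐ[ℚ] Polynomial ℂ :=
  aeval ![Polynomial.C (1 / 2) * (lineRoot ζ + Polynomial.X),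
    Polynomial.C (-Complex.I / 2) * (lineRoot ζ - Polynomial.X), 1]

/-- Substitution of `(u + v)/2`, `(u - v)/(2i)` and `1` for `x, y, z`. -/
noncomputable def toUV : MvPolynomial (Fin 3) ℚ →ₐ[ℚ] Polynomial (Polynomial ℂ) :=
  aeval ![Polynomial.C (Polynomial.C (1 / 2)) * (Polynomial.X + Polynomial.C Polynomial.X),
    Polynomial.C (Polynomial.C (-Complex.I / 2)) * (Polynomial.X - Polynomial.C Polynomial.X), 1]

lemma natDegree_lineRoot_le (ζ : ℂ) : (lineRoot ζ).natDegree ≤ 1 := by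
  unfold lineRoot; compute_degree

lemma eval_lineRoot_toUV (ζ : ℂ) (F : MvPolynomial (Fin 3) ℚ) :
    (toUV F).eval (lineRoot ζ) = restrictLine ζ F := by
  have h := comp_aeval_apply (R := ℚ)
    ![Polynomial.C (Polynomial.C (1 / 2)) * (Polynomial.X + Polynomial.C Polynomial.X),
    Polynomial.C (Polynomial.C (-Complex.I / 2)) * (Polynomial.X - Polynomial.C Polynomial.X), 1]
    (Polynomial.evalRingHom (lineRoot ζ)).toRatAlgHom F
  simp only [RingHom.toRatAlgHom_apply, Polynomial.coe_evalRingHom] at h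
  rw [toUV, h, restrictLine]
  congr 2
  funext i
  fin_cases i <;> simp

lemma natDegree_toUV_le {t : ℕ} {F : MvPolynomial (Fin 3) ℚ} (hF : F.IsHomogeneous t) :
    (toUV F).natDegree ≤ t := by
  refine natDegree_aeval_le hF _ fun i ↦ ?_
  fin_cases i
  · simpa using (Polynomial.natDegree_C_mul_le _ _).trans (by compute_degree)
  · simpa using (Polynomial.natDegree_C_mul_le _ _).trans (by compute_degree)
  · simp

lemma natDegree_restrictLine_le {t : ℕ} {F : MvPolynomial (Fin 3) ℚ} (hF : F.IsHomogeneous t)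
    (ζ : ℂ) : (restrictLine ζ F).natDegree ≤ t := by
  refine natDegree_aeval_le hF _ fun i ↦ ?_
  have h := natDegree_lineRoot_le ζ
  fin_cases i
  · exact (Polynomial.natDegree_C_mul_le _ _).trans
      ((Polynomial.natDegree_add_le _ _).trans (by simpa using h))
  · exact (Polynomial.natDegree_C_mul_le _ _).trans
      ((Polynomial.natDegree_sub_le _ _).trans (by simpa using h))
  · simp

section Scaling

variable {A : Type*} [CommRing A] (n a b c : A)

lemma g₀_scale : g₀ (n*a) (n*b) (n*c) = n^4 * g₀ a b c := by unfold g₀; ring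

lemma g₁_scale : g₁ (n*a) (n*b) (n*c) = n^5 * g₁ a b c := by unfold g₁; ring

lemma g₂_scale : g₂ (n*a) (n*b) (n*c) = n^5 * g₂ a b c := by unfold g₂; ring

lemma g₃_scale : g₃ (n*a) (n*b) (n*c) = n^5 * g₃ a b c := by unfold g₃; ring

end Scaling

lemma natDegree_quartic (a b c : ℂ) (hb : b ≠ 0) :
    (quartic (Polynomial.C a) (Polynomial.C b * (Polynomial.X - Polynomial.C c))).natDegree
      = 4 := by
  have h : quartic (Polynomial.C a) (Polynomial.C b * (Polynomial.X - Polynomial.C c)) =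
      (quartic (Polynomial.C a) Polynomial.X).comp
        (Polynomial.C b * (Polynomial.X - Polynomial.C c)) := by
    simp [quartic]
  have h4 : (quartic (Polynomial.C a) Polynomial.X).natDegree = 4 := by
    have e : quartic (Polynomial.C a) Polynomial.X =
        Polynomial.X ^ 4 + Polynomial.C (a + 1) * Polynomial.X ^ 3
        + Polynomial.C (a ^ 2 + a - 4) * Polynomial.X ^ 2
        + Polynomial.C (a ^ 3 + a ^ 2 - 4 * a - 3) * Polynomial.X
        + Polynomial.C (a ^ 4 + a ^ 3 - 4 * a ^ 2 - 3 * a + 3) := by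
      simp [quartic, map_ofNat Polynomial.C]
    rw [e]; compute_degree!
  rw [h, Polynomial.natDegree_comp, h4, Polynomial.natDegree_C_mul hb,
    Polynomial.natDegree_X_sub_C]

lemma restrictLine_gens (ζ : ℂ) :
    restrictLine ζ x = Polynomial.C (1 / 2) * (lineRoot ζ + Polynomial.X) ∧
    restrictLine ζ y = Polynomial.C (1 / 2) *
      (Polynomial.C (-Complex.I) * (lineRoot ζ - Polynomial.X)) ∧
    restrictLine ζ z = Polynomial.C (1 / 2) * 2 := by
  have h2 : (Polynomial.C (1 / 2 : ℂ)) * 2 = 1 := by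
    rw [← map_ofNat Polynomial.C 2, ← map_mul]; norm_num
  refine ⟨by simp [restrictLine, x], ?_, by simp only [restrictLine, z, aeval_X, h2]; simp⟩
  simp only [restrictLine, y, aeval_X, ← mul_assoc, ← map_mul]
  rw [show 1 / 2 * -Complex.I = -Complex.I / 2 by ring]
  simp

/-- Each of the eleven lines contains at least four triple points. -/
lemma exists_dvd_restrictLine {ζ : ℂ} (hζ : ζ ^ 11 = 1) :
    ∃ P : Polynomial ℂ, 4 ≤ P.natDegree ∧
      I₁₁.map (restrictLine ζ : MvPolynomial (Fin 3) ℚ →+* Polynomial ℂ) ≤ Ideal.span {P} := by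
  obtain ⟨hx, hy, hz⟩ := restrictLine_gens ζ
  by_cases h1 : ζ = 1
  · subst h1
    have hr : lineRoot 1 = Polynomial.X := by simp [lineRoot]
    refine ⟨Polynomial.X ^ 5 - 4 * Polynomial.X ^ 4 + 2 * Polynomial.X ^ 3 + 5 * Polynomial.X ^ 2
      - 2 * Polynomial.X - 1, ?_, ?_⟩
    · have : (Polynomial.X ^ 5 - 4 * Polynomial.X ^ 4 + 2 * Polynomial.X ^ 3
        + 5 * Polynomial.X ^ 2 - 2 * Polynomial.X - 1 : Polynomial ℂ).natDegree = 5 := by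
        compute_degree!
      omega
    have h2 : (Polynomial.C (1 / 2 : ℂ)) * 2 = 1 := by
      rw [← map_ofNat Polynomial.C 2, ← map_mul]; norm_num
    have hx' : restrictLine 1 x = Polynomial.X := by
      rw [hx, hr]; linear_combination Polynomial.X * h2
    have hy' : restrictLine 1 y = 0 := by rw [hy, hr]; ring
    have hz' : restrictLine 1 z = 1 := by rw [hz, h2]
    apply map_mem_of_mem_I₁₁ <;>
      simp only [AlgHom.coe_toRingHom, hx', hy', hz', Ideal.mem_span_singleton]
    · exact ⟨0, by unfold g₀; ring⟩
    · exact ⟨0, by unfold g₁; ring⟩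
    · exact ⟨0, by unfold g₂; ring⟩
    · exact ⟨2, by unfold g₃; ring⟩
  · have hΦ : 1 + ζ + ζ^2 + ζ^3 + ζ^4 + ζ^5 + ζ^6 + ζ^7 + ζ^8 + ζ^9 + ζ^10 = 0 := by
      refine mul_left_cancel₀ (sub_ne_zero.2 h1) ?_
      linear_combination hζ
    have h0 : ζ ≠ 0 := by rintro rfl; norm_num at hζ
    set e : Polynomial ℂ := Polynomial.C ζ with he_def
    set w : Polynomial ℂ := Polynomial.C (ζ ^ 10) * (Polynomial.X - Polynomial.C (ζ ^ 9))
      with hw_def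
    set J : Polynomial ℂ := Polynomial.C (-Complex.I) with hJ_def
    have h11 : e ^ 11 = 1 := by rw [he_def, ← map_pow, hζ, map_one]
    have he : 1 + e + e^2 + e^3 + e^4 + e^5 + e^6 + e^7 + e^8 + e^9 + e^10 = 0 := by
      simpa using congrArg Polynomial.C hΦ
    have hJ : J ^ 2 = -1 := by
      rw [hJ_def, ← map_pow, neg_sq, Complex.I_sq, map_neg, map_one]
    have hw : w = e ^ 10 * (Polynomial.X - e ^ 9) := by simp [hw_def, he_def]
    have hv : (Polynomial.X : Polynomial ℂ) = e^9 + e*w := by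
      rw [hw]; linear_combination (e^9 - Polynomial.X) * h11
    have hu : lineRoot ζ = e^2 + e^10*w := by
      have : lineRoot ζ = e ^ 9 * Polynomial.X + (e ^ 2 - e ^ 7) := by
        simp [lineRoot, he_def]
      rw [this, hw]
      linear_combination (e^7 * (e ^ 11 + 1) - e ^ 9 * Polynomial.X) * h11
    rw [hu, hv] at hx hy
    refine ⟨quartic (e^3 + e^8) w, ?_, ?_⟩
    · have := natDegree_quartic (ζ^3 + ζ^8) (ζ^10) (ζ^9) (pow_ne_zero _ h0)
      rw [map_add, map_pow, map_pow] at this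
      exact this.ge
    apply map_mem_of_mem_I₁₁ <;>
      simp only [AlgHom.coe_toRingHom, hx, hy, hz, g₀_scale, g₁_scale, g₂_scale, g₃_scale] <;>
      refine Ideal.mul_mem_left _ _ ?_ <;> rw [Ideal.mem_span_singleton]
    · exact ⟨_, g₀_on_line hJ he⟩
    · exact ⟨_, g₁_on_line hJ he⟩
    · exact ⟨_, g₂_on_line hJ he⟩
    · exact ⟨_, g₃_on_line hJ he⟩

lemma restrictLine_eq_zero {t k : ℕ} {F : MvPolynomial (Fin 3) ℚ} (hF : F.IsHomogeneous t)
    (ht : t ≤ 11) (hFz : F * z ^ k ∈ I₁₁ ^ 3) {ζ : ℂ} (hζ : ζ ^ 11 = 1) :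
    restrictLine ζ F = 0 := by
  obtain ⟨P, hP, hI⟩ := exists_dvd_restrictLine hζ
  have h := map_mem_pow _ hI hFz
  have hz : restrictLine ζ z = 1 := by simp [restrictLine, z]
  rw [AlgHom.coe_toRingHom, map_mul, map_pow, hz, one_pow, mul_one, Ideal.span_singleton_pow,
    Ideal.mem_span_singleton] at h
  refine Polynomial.eq_zero_of_dvd_of_natDegree_lt h ?_
  have := natDegree_restrictLine_le hF ζ
  rw [Polynomial.natDegree_pow]
  omega

lemma toUV_eq_zero {t k : ℕ} {F : MvPolynomial (Fin 3) ℚ} (hF : F.IsHomogeneous t)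
    (ht : t ≤ 10) (hFz : F * z ^ k ∈ I₁₁ ^ 3) : toUV F = 0 := by
  have hη := Complex.isPrimitiveRoot_exp 11 (by norm_num)
  set η := Complex.exp (2 * Real.pi * Complex.I / (11 : ℕ))
  have h11 (i : ℕ) : (η ^ i) ^ 11 = 1 := by rw [← pow_mul, mul_comm, pow_mul, hη.pow_eq_one,
    one_pow]
  refine Polynomial.eq_zero_of_natDegree_lt_card_of_eval_eq_zero (toUV F)
    (f := fun i : Fin 11 ↦ lineRoot (η ^ (i : ℕ))) ?_ ?_ ?_
  · intro i j hij
    have h9 : (η ^ (i : ℕ)) ^ 9 = (η ^ (j : ℕ)) ^ 9 := by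
      simpa [lineRoot, Polynomial.coeff_C, -map_sub, -map_pow]
        using congrArg (Polynomial.coeff · 1) hij
    refine Fin.ext (hη.pow_inj i.2 j.2 ?_)
    have h45 (a : ℂ) (ha : a ^ 11 = 1) : a = (a ^ 9) ^ 5 := by
      linear_combination (-a * (a ^ 33 + a ^ 22 + a ^ 11 + 1)) * ha
    rw [h45 _ (h11 i), h45 _ (h11 j), h9]
  · intro i
    rw [eval_lineRoot_toUV]
    exact restrictLine_eq_zero hF (by omega) hFz (h11 i)
  · have := natDegree_toUV_le hF
    rw [Fintype.card_fin]
    omega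

lemma eval_eq_zero_of_toUV_eq_zero {F : MvPolynomial (Fin 3) ℚ} (h : toUV F = 0) (a b : ℚ) :
    eval ![a, b, 1] F = 0 := by
  have hc := comp_aeval_apply (R := ℚ)
    ![Polynomial.C (Polynomial.C (1 / 2)) * (Polynomial.X + Polynomial.C Polynomial.X),
    Polynomial.C (Polynomial.C (-Complex.I / 2)) * (Polynomial.X - Polynomial.C Polynomial.X), 1]
    ((Polynomial.evalRingHom (a - b * Complex.I)).comp
      (Polynomial.evalRingHom (Polynomial.C (a + b * Complex.I)))).toRatAlgHom F
  rw [← toUV, h, map_zero] at hc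
  have hv : (fun i : Fin 3 ↦ ((Polynomial.evalRingHom (a - b * Complex.I)).comp
      (Polynomial.evalRingHom (Polynomial.C (a + b * Complex.I)))).toRatAlgHom
      ((![Polynomial.C (Polynomial.C (1 / 2)) * (Polynomial.X + Polynomial.C Polynomial.X),
        Polynomial.C (Polynomial.C (-Complex.I / 2)) *
          (Polynomial.X - Polynomial.C Polynomial.X), 1] : Fin 3 → Polynomial (Polynomial ℂ)) i))
      = fun i ↦ algebraMap ℚ ℂ ((![a, b, 1] : Fin 3 → ℚ) i) := by
    funext i
    fin_cases i
    · simp; ring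
    · simp; linear_combination (-b : ℂ) * Complex.I_sq
    · simp
  have he := comp_aeval_apply (R := ℚ) ![a, b, 1] (Algebra.ofId ℚ ℂ) F
  simp only [Algebra.ofId_apply] at he
  rw [hv, ← he, aeval_eq_eval] at hc
  simpa using hc.symm

lemma eval_mul_of_isHomogeneous {t : ℕ} {F : MvPolynomial (Fin 3) ℚ} (hF : F.IsHomogeneous t)
    (r : ℚ) (p : Fin 3 → ℚ) : eval (fun i ↦ r * p i) F = r ^ t * eval p F := by
  rw [eval_eq', eval_eq', Finset.mul_sum]
  refine Finset.sum_congr rfl fun d hd ↦ ?_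
  have h : t = ∑ i, d i := by
    rw [hF.degree_eq_sum_deg_support hd, ← Finsupp.degree_apply, Finsupp.degree_eq_sum]
  simp_rw [mul_pow, Finset.prod_mul_distrib, Finset.prod_pow_eq_pow_sum, ← h]
  ring

lemma eval_eq_zero_of_isHomogeneous {t : ℕ} {F : MvPolynomial (Fin 3) ℚ}
    (hF : F.IsHomogeneous t) (h : ∀ a b : ℚ, eval ![a, b, 1] F = 0) : F = 0 := by
  have hz : F * z = 0 := by
    refine MvPolynomial.funext fun p ↦ ?_
    rw [map_mul, map_zero]
    by_cases hp : p 2 = 0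
    · simp [z, hp]
    · have hs : eval p F = p 2 ^ t * eval ![p 0 / p 2, p 1 / p 2, 1] F := by
        rw [← eval_mul_of_isHomogeneous hF]
        congr 2
        funext i
        fin_cases i <;> simp [mul_div_cancel₀ _ hp]
      rw [hs, h, mul_zero, zero_mul]
  exact (mul_eq_zero.1 hz).resolve_right (X_ne_zero 2)

/-- A form of degree at most ten vanishing to order three at the triple points is zero. -/
lemma eq_zero_of_degree_le_ten {t k : ℕ} {F : MvPolynomial (Fin 3) ℚ}
    (hF : F.IsHomogeneous t) (ht : t ≤ 10) (hFz : F * z ^ k ∈ I₁₁ ^ 3) : F = 0 :=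
  eval_eq_zero_of_isHomogeneous hF (eval_eq_zero_of_toUV_eq_zero (toUV_eq_zero hF ht hFz))

end Bezout

lemma eq_zero_of_natCast_mul_eq_zero {A : Type*} [CommRing A] [Algebra ℚ A] {n : ℕ}
    (hn : n ≠ 0) {a : A} (h : (n : A) * a = 0) : a = 0 := by
  have h' : (n : ℚ) • a = 0 := by rw [Algebra.smul_def, map_natCast, h]
  exact (smul_eq_zero.1 h').resolve_left (Nat.cast_ne_zero.2 hn)

section ModZ

attribute [local instance] MvPolynomial.gradedAlgebra

/-- If all products of two generators vanish at `(a, b, 0)`, then so do all binary monomials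
of degree ten. -/
lemma pow_mul_pow_eq_zero {A : Type*} [CommRing A] [Algebra ℚ A] {a b : A}
    (H : ∀ p ∈ ({g₀ a b 0, g₁ a b 0, g₂ a b 0, g₃ a b 0} : Set A),
      ∀ q ∈ ({g₀ a b 0, g₁ a b 0, g₂ a b 0, g₃ a b 0} : Set A), p * q = 0)
    {i j : ℕ} (hij : 10 = i + j) : a ^ i * b ^ j = 0 := by
  simp only [Set.mem_insert_iff, Set.mem_singleton_iff, forall_eq_or_imp, forall_eq] at H
  obtain ⟨⟨h00, h01, h02, h03⟩, ⟨-, h11, h12, h13⟩, ⟨-, -, h22, h23⟩, -, -, -, h33⟩ := H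
  have hi : i ≤ 10 := by omega
  obtain rfl : j = 10 - i := by omega
  refine eq_zero_of_natCast_mul_eq_zero (n := 1024) (by norm_num) ?_
  push_cast
  unfold g₀ g₁ g₂ g₃ at *
  interval_cases i
  · linear_combination h11
  · linear_combination -4 * h13 + 2 * b * h01 + 2 * b * h02
  · linear_combination h12
  · linear_combination -4 * h23 + 4 * b * h02 + 16 * a * b * h00
  · linear_combination h22
  · linear_combination -4 * h23 + 12 * b * h02 + 16 * a * b * h00
  · linear_combination h22 + 8 * a * h02
  · linear_combination -4 * h23 + 20 * b * h02 + 80 * a * b * h00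
  · linear_combination h22 + 64 * a^2 * h00 + 16 * a * h02
  · linear_combination -4 * h23 + 128 * a * h03 + 60 * b * h02 + 80 * a * b * h00
  · linear_combination -15 * h12 + 256 * h33 + 160 * a * h01 + 640 * b^2 * h00

lemma monomial_eq_xyz (d : Fin 3 →₀ ℕ) (c : ℚ) :
    monomial d c = C c * (x ^ d 0 * y ^ d 1 * z ^ d 2) := by
  rw [monomial_eq, Finsupp.prod_fintype _ _ (fun _ ↦ pow_zero _), Fin.prod_univ_three, x, y, z]

lemma exponents_sum {t : ℕ} {F : MvPolynomial (Fin 3) ℚ} (hF : F.IsHomogeneous t)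
    {d : Fin 3 →₀ ℕ} (hd : d ∈ F.support) : d 0 + d 1 + d 2 = t := by
  rw [hF.degree_eq_sum_deg_support hd, ← Finsupp.degree_apply, Finsupp.degree_eq_sum,
    Fin.sum_univ_three]

lemma mem_sq_sup_span_z {t : ℕ} (ht : 10 ≤ t) {F : MvPolynomial (Fin 3) ℚ}
    (hF : F.IsHomogeneous t) : F ∈ I₁₁ ^ 2 ⊔ Ideal.span {z} := by
  set K := I₁₁ ^ 2 ⊔ Ideal.span {z} with hK
  have hz : z ∈ K := Ideal.mem_sup_right (Ideal.mem_span_singleton_self z)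
  rw [F.as_sum]
  refine Ideal.sum_mem _ fun d hd ↦ ?_
  rw [monomial_eq_xyz]
  refine Ideal.mul_mem_left _ _ ?_
  have hsum := exponents_sum hF hd
  by_cases h2 : d 2 = 0
  · have hxy : ∀ i j : ℕ, 10 = i + j → x ^ i * y ^ j ∈ K := by
      intro i j hij
      rw [← Ideal.Quotient.eq_zero_iff_mem, map_mul, map_pow, map_pow]
      refine pow_mul_pow_eq_zero ?_ hij
      have hz0 : Ideal.Quotient.mk K z = 0 := Ideal.Quotient.eq_zero_iff_mem.2 hz
      obtain ⟨m₀, m₁, m₂, m₃⟩ := gens_mem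
      have lift : ∀ p ∈ ({g₀ (Ideal.Quotient.mk K x) (Ideal.Quotient.mk K y) 0,
          g₁ (Ideal.Quotient.mk K x) (Ideal.Quotient.mk K y) 0,
          g₂ (Ideal.Quotient.mk K x) (Ideal.Quotient.mk K y) 0,
          g₃ (Ideal.Quotient.mk K x) (Ideal.Quotient.mk K y) 0} :
            Set (MvPolynomial (Fin 3) ℚ ⧸ K)),
          ∃ p' ∈ I₁₁, Ideal.Quotient.mk K p' = p := by
        simp only [Set.mem_insert_iff, Set.mem_singleton_iff, forall_eq_or_imp, forall_eq]
        exact ⟨⟨_, m₀, by rw [map_g₀, hz0]⟩, ⟨_, m₁, by rw [map_g₁, hz0]⟩,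
          ⟨_, m₂, by rw [map_g₂, hz0]⟩, ⟨_, m₃, by rw [map_g₃, hz0]⟩⟩
      intro p hp q hq
      obtain ⟨p', hp', rfl⟩ := lift p hp
      obtain ⟨q', hq', rfl⟩ := lift q hq
      rw [← map_mul, Ideal.Quotient.eq_zero_iff_mem, hK, pow_two]
      exact Ideal.mem_sup_left (Ideal.mul_mem_mul hp' hq')
    rw [h2, pow_zero, mul_one]
    obtain ⟨i, i', j, j', hi, hj, hij⟩ :
        ∃ i i' j j' : ℕ, d 0 = i + i' ∧ d 1 = j + j' ∧ 10 = i + j :=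
      ⟨min (d 0) 10, d 0 - min (d 0) 10, 10 - min (d 0) 10, d 1 - (10 - min (d 0) 10),
        by omega, by omega, by omega⟩
    have e : x ^ d 0 * y ^ d 1 = x ^ i' * y ^ j' * (x ^ i * y ^ j) := by rw [hi, hj]; ring
    rw [e]
    exact Ideal.mul_mem_left _ _ (hxy i j hij)
  · exact Ideal.mul_mem_left _ _ (Ideal.pow_mem_of_mem _ hz _ (Nat.pos_of_ne_zero h2))

lemma exists_sub_z_mul_mem {n : ℕ} (hn : 9 ≤ n) {F : MvPolynomial (Fin 3) ℚ}
    (hF : F.IsHomogeneous (n + 1)) :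
    ∃ G : MvPolynomial (Fin 3) ℚ, G.IsHomogeneous n ∧ F - G * z ∈ I₁₁ ^ 2 := by
  obtain ⟨q, hq, r, hr, hqr⟩ := Submodule.mem_sup.1 (mem_sq_sup_span_z (by omega) hF)
  obtain ⟨G, rfl⟩ := Ideal.mem_span_singleton'.1 hr
  refine ⟨homogeneousComponent n G, homogeneousComponent_isHomogeneous n G, ?_⟩
  have h := congrArg (homogeneousComponent (n + 1)) hqr
  rw [map_add, homogeneousComponent_mul_z, homogeneousComponent_of_mem hF, if_pos rfl] at h
  rw [← h, add_sub_cancel_right]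
  exact homogeneousComponent_mem_of_mem (I₁₁_pow_isHomogeneous 2) hq _

lemma exists_sub_z_pow_mul_mem (s : ℕ) {F : MvPolynomial (Fin 3) ℚ}
    (hF : F.IsHomogeneous (9 + s)) :
    ∃ G : MvPolynomial (Fin 3) ℚ, G.IsHomogeneous 9 ∧ F - G * z ^ s ∈ I₁₁ ^ 2 := by
  induction s generalizing F with
  | zero => exact ⟨F, hF, by simp⟩
  | succ s ih =>
    obtain ⟨F', hF', h⟩ := exists_sub_z_mul_mem (n := 9 + s) (by omega) hF
    obtain ⟨G, hG, h'⟩ := ih hF'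
    refine ⟨G, hG, ?_⟩
    have e : F - G * z ^ (s + 1) = (F - F' * z) + z * (F' - G * z ^ s) := by ring
    rw [e]
    exact add_mem h (Ideal.mul_mem_left _ _ h')

end ModZ

section StandardMonomials

/-- The monomial of degree eleven with the given exponents of `x` and `y`. -/
noncomputable def mon (a b : ℕ) : MvPolynomial (Fin 3) ℚ := x ^ a * y ^ b * z ^ (11 - a - b)

/-- Exponents of `x` and `y` of the standard monomials of degree eleven. -/
def stdExponents : Finset (ℕ × ℕ) :=
  (Finset.range 10 ×ˢ Finset.range 10).filter fun p ↦ p.1 + p.2 ≤ 9 ∧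
    p ∉ ({(8, 1), (7, 2), (6, 3), (5, 4), (4, 5), (3, 6), (2, 7), (1, 8), (7, 1), (6, 2)} :
      Finset (ℕ × ℕ))

/-- The span of the standard monomials of degree eleven. -/
noncomputable def stdSpan : Submodule ℚ (MvPolynomial (Fin 3) ℚ) :=
  Submodule.span ℚ (stdExponents.image fun p ↦ mon p.1 p.2)

lemma mon_mem_stdSpan {a b : ℕ} (h : (a, b) ∈ stdExponents) : mon a b ∈ stdSpan :=
  Submodule.subset_span (Finset.mem_coe.2 (Finset.mem_image.2 ⟨(a, b), h, rfl⟩))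

lemma finrank_stdSpan_le : Module.finrank ℚ stdSpan ≤ 45 := by
  refine (finrank_span_finset_le_card _).trans (Finset.card_image_le.trans ?_)
  decide

/-- Forms congruent to a combination of standard monomials modulo the square of `I₁₁`. -/
noncomputable def reducible : Submodule ℚ (MvPolynomial (Fin 3) ℚ) :=
  stdSpan ⊔ (I₁₁ ^ 2).restrictScalars ℚ

lemma list_sum_mem_stdSpan (l : List (ℤ × ℕ × ℕ)) (hl : ∀ p ∈ l, p.2 ∈ stdExponents) :
    (l.map fun p ↦ (p.1 : MvPolynomial (Fin 3) ℚ) * mon p.2.1 p.2.2).sum ∈ stdSpan := by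
  refine list_sum_mem fun q hq ↦ ?_
  obtain ⟨p, hp, rfl⟩ := List.mem_map.1 hq
  rw [← zsmul_eq_mul]
  exact zsmul_mem (mon_mem_stdSpan (hl p hp)) _

lemma mon_mem_reducible_of_eq {n : ℕ} (hn : n ≠ 0) {a b : ℕ} (l : List (ℤ × ℕ × ℕ))
    (hl : ∀ p ∈ l, p.2 ∈ stdExponents) {q : MvPolynomial (Fin 3) ℚ} (hq : q ∈ I₁₁ ^ 2)
    (h : (n : MvPolynomial (Fin 3) ℚ) * mon a b =
      (l.map fun p ↦ (p.1 : MvPolynomial (Fin 3) ℚ) * mon p.2.1 p.2.2).sum + q) :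
    mon a b ∈ reducible := by
  have hmem : (n : ℚ) • mon a b ∈ reducible := by
    rw [Algebra.smul_def, map_natCast, h]
    exact Submodule.add_mem_sup (list_sum_mem_stdSpan l hl) hq
  exact (Submodule.smul_mem_iff _ (Nat.cast_ne_zero.2 hn)).1 hmem

lemma quadratic_mem_sq (p₀₀ p₀₁ p₀₂ p₀₃ p₁₁ p₁₂ p₁₃ p₂₂ p₂₃ p₃₃ : MvPolynomial (Fin 3) ℚ) :
    g₀ x y z * (p₀₀ * g₀ x y z + p₀₁ * g₁ x y z + p₀₂ * g₂ x y z + p₀₃ * g₃ x y z)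
      + g₁ x y z * (p₁₁ * g₁ x y z + p₁₂ * g₂ x y z + p₁₃ * g₃ x y z)
      + g₂ x y z * (p₂₂ * g₂ x y z + p₂₃ * g₃ x y z)
      + g₃ x y z * (p₃₃ * g₃ x y z) ∈ I₁₁ ^ 2 := by
  obtain ⟨h₀, h₁, h₂, h₃⟩ := gens_mem
  rw [pow_two]
  have m {p q : MvPolynomial (Fin 3) ℚ} (hp : p ∈ I₁₁) := Ideal.mul_mem_left I₁₁ q hp
  refine add_mem (add_mem (add_mem ?_ ?_) ?_) ?_ <;>
    refine Ideal.mul_mem_mul (by assumption) ?_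
  · exact add_mem (add_mem (add_mem (m h₀) (m h₁)) (m h₂)) (m h₃)
  · exact add_mem (add_mem (m h₁) (m h₂)) (m h₃)
  · exact add_mem (m h₂) (m h₃)
  · exact m h₃

lemma mon_8_1_mem_reducible : mon 8 1 ∈ reducible := by
  refine mon_mem_reducible_of_eq (n := 5632) (by norm_num)
    ([(3584, 0, 9), (107008, 5, 3), (-50688, 3, 5), (-8192, 1, 7), (61952, 6, 1), (224928, 4, 3),
     (-310464, 2, 5), (-32096, 0, 7), (19360, 5, 1), (-235840, 3, 3), (-322784, 1, 5),
     (-235136, 4, 1), (-157696, 2, 3), (-22528, 0, 5), (16192, 3, 1), (256960, 1, 3),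
     (181280, 2, 1), (65824, 0, 3), (-33088, 1, 1), (-24992, 0, 1)])
    (by decide) (quadratic_mem_sq
      (-38166*y*z^2 + 7288*x*y*z + 3328*y^3) (2531*y*z + 2728*x*y) (-6325*y*z) (7568*z^2) 0 (29*y)
      (-790*z - 832*x) (-237*y) (466*z) 0) ?_
  simp only [List.map_cons, List.map_nil, List.sum_cons, List.sum_nil, mon, g₀, g₁, g₂, g₃,
    Nat.reduceSub]
  push_cast
  ring

lemma mon_7_2_mem_reducible : mon 7 2 ∈ reducible := by
  refine mon_mem_reducible_of_eq (n := 1024) (by norm_num)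
    ([(-2464, 4, 4), (1728, 2, 6), (-32, 0, 8), (1344, 5, 2), (-288, 3, 4), (2976, 1, 6),
     (1586, 4, 2), (3076, 2, 4), (1426, 0, 6), (376, 3, 2), (-648, 1, 4), (-2064, 2, 2),
     (-1816, 0, 4), (-720, 1, 2), (584, 0, 2)])
    (by decide) (quadratic_mem_sq
      (162*z^3 + 64*x*z^2) (-12*z^2 - 8*x*z) (38*z^2) 0 0 (-z) 0 (z) 0 0) ?_
  simp only [List.map_cons, List.map_nil, List.sum_cons, List.sum_nil, mon, g₀, g₁, g₂, g₃,
    Nat.reduceSub]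
  push_cast
  ring

lemma mon_6_3_mem_reducible : mon 6 3 ∈ reducible := by
  refine mon_mem_reducible_of_eq (n := 22528) (by norm_num)
    ([(4096, 0, 9), (-33792, 5, 3), (39424, 3, 5), (-6656, 1, 7), (-22528, 6, 1), (232672, 4, 3),
     (-120384, 2, 5), (-34592, 0, 7), (103840, 5, 1), (-52800, 3, 3), (-201696, 1, 5),
     (-99968, 4, 1), (-185856, 2, 3), (8448, 0, 5), (-85184, 3, 1), (138688, 1, 3),
     (113696, 2, 1), (29216, 0, 3), (-4928, 1, 1), (-13728, 0, 1)])
    (by decide) (quadratic_mem_sq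
      (-10510*y*z^2 + 2264*x*y*z) (1375*y*z + 968*x*y) (-2617*y*z + 128*x*y) (2112*z^2) 0 (41*y)
      (-366*z - 256*x) (-105*y) (138*z) 0) ?_
  simp only [List.map_cons, List.map_nil, List.sum_cons, List.sum_nil, mon, g₀, g₁, g₂, g₃,
    Nat.reduceSub]
  push_cast
  ring

lemma mon_5_4_mem_reducible : mon 5 4 ∈ reducible := by
  refine mon_mem_reducible_of_eq (n := 1024) (by norm_num)
    ([(-4000, 4, 4), (1728, 2, 6), (-32, 0, 8), (-1056, 5, 2), (416, 3, 4), (3008, 1, 6),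
     (1738, 4, 2), (5044, 2, 4), (1450, 0, 6), (2200, 3, 2), (24, 1, 4), (-2288, 2, 2),
     (-1880, 0, 4), (-1232, 1, 2), (616, 0, 2)])
    (by decide) (quadratic_mem_sq
      (66*z^3) (-12*z^2 - 8*x*z) (30*z^2) 0 0 (-z) 0 (z) 0 0) ?_
  simp only [List.map_cons, List.map_nil, List.sum_cons, List.sum_nil, mon, g₀, g₁, g₂, g₃,
    Nat.reduceSub]
  push_cast
  ring

lemma mon_4_5_mem_reducible : mon 4 5 ∈ reducible := by
  refine mon_mem_reducible_of_eq (n := 11264) (by norm_num)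
    ([(1024, 0, 9), (-16896, 5, 3), (-5632, 3, 5), (-3072, 1, 7), (-5632, 6, 1), (48928, 4, 3),
     (-31680, 2, 5), (-9440, 0, 7), (24992, 5, 1), (6336, 3, 3), (-41184, 1, 5), (-21120, 4, 1),
     (-33792, 2, 3), (5632, 0, 5), (-23232, 3, 1), (26048, 1, 3), (23584, 2, 1), (3872, 0, 3),
     (704, 1, 1), (-2464, 0, 1)])
    (by decide) (quadratic_mem_sq
      (-3238*y*z^2 + 632*x*y*z) (363*y*z + 264*x*y) (-701*y*z + 32*x*y) (528*z^2) 0 (13*y)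
      (-86*z - 64*x) (-29*y) (18*z) 0) ?_
  simp only [List.map_cons, List.map_nil, List.sum_cons, List.sum_nil, mon, g₀, g₁, g₂, g₃,
    Nat.reduceSub]
  push_cast
  ring

lemma mon_3_6_mem_reducible : mon 3 6 ∈ reducible := by
  refine mon_mem_reducible_of_eq (n := 1024) (by norm_num)
    ([(-2464, 4, 4), (-1344, 2, 6), (-32, 0, 8), (-704, 5, 2), (-1056, 3, 4), (160, 1, 6),
     (770, 4, 2), (4004, 2, 4), (610, 0, 6), (1848, 3, 2), (1848, 1, 4), (-1232, 2, 2),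
     (-792, 0, 4), (-1232, 1, 2), (264, 0, 2)])
    (by decide) (quadratic_mem_sq
      (66*z^3) (-12*z^2 - 8*x*z) (22*z^2) 0 0 (-z) 0 (z) 0 0) ?_
  simp only [List.map_cons, List.map_nil, List.sum_cons, List.sum_nil, mon, g₀, g₁, g₂, g₃,
    Nat.reduceSub]
  push_cast
  ring

lemma mon_2_7_mem_reducible : mon 2 7 ∈ reducible := by
  refine mon_mem_reducible_of_eq (n := 2048) (by norm_num)
    ([(-5632, 3, 5), (-3584, 1, 7), (-2464, 4, 3), (-4928, 2, 5), (-1440, 0, 7), (-352, 5, 1),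
     (3520, 3, 3), (3872, 1, 5), (1408, 4, 1), (5632, 2, 3), (2816, 0, 5), (-704, 3, 1),
     (-2112, 1, 3), (-1760, 2, 1), (-1760, 0, 3), (704, 1, 1), (352, 0, 1)])
    (by decide) (quadratic_mem_sq
      (-94*y*z^2 + 24*x*y*z) (7*y*z + 8*x*y) (-17*y*z) 0 0 (y) (2*z) (-y) (-6*z) 0) ?_
  simp only [List.map_cons, List.map_nil, List.sum_cons, List.sum_nil, mon, g₀, g₁, g₂, g₃,
    Nat.reduceSub]
  push_cast
  ring

lemma mon_1_8_mem_reducible : mon 1 8 ∈ reducible := by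
  refine mon_mem_reducible_of_eq (n := 1024) (by norm_num)
    ([(352, 4, 4), (-4928, 2, 6), (-800, 0, 8), (352, 5, 2), (-5984, 3, 4), (-704, 1, 6),
     (-2134, 4, 2), (5236, 2, 4), (2442, 0, 6), (3608, 3, 2), (5016, 1, 4), (-176, 2, 2),
     (-2200, 0, 4), (-2640, 1, 2), (616, 0, 2)])
    (by decide) (quadratic_mem_sq
      (66*z^3) (-20*z^2 - 8*x*z) (22*z^2) 0 0 (-z) 0 (z) 0 0) ?_
  simp only [List.map_cons, List.map_nil, List.sum_cons, List.sum_nil, mon, g₀, g₁, g₂, g₃,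
    Nat.reduceSub]
  push_cast
  ring

lemma mon_7_1_mem_reducible : mon 7 1 ∈ reducible := by
  refine mon_mem_reducible_of_eq (n := 176) (by norm_num)
    ([(880, 5, 3), (-528, 3, 5), (-48, 1, 7), (704, 6, 1), (352, 4, 3), (-1408, 2, 5), (-32, 0, 7),
     (-264, 5, 1), (-1232, 3, 3), (-968, 1, 5), (-1232, 4, 1), (-176, 0, 5), (528, 3, 1),
     (880, 1, 3), (616, 2, 1), (264, 0, 3), (-176, 1, 1), (-88, 0, 1)])
    (by decide) (quadratic_mem_sq
      (-96*y*z^2 - 16*x*y*z + 16*x^2*y) 0 (-25*y*z + 4*x*y) (11*z^2) 0 0 0 (-y) (3*z - 4*x) 0) ?_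
  simp only [List.map_cons, List.map_nil, List.sum_cons, List.sum_nil, mon, g₀, g₁, g₂, g₃,
    Nat.reduceSub]
  push_cast
  ring

lemma mon_6_2_mem_reducible : mon 6 2 ∈ reducible := by
  refine mon_mem_reducible_of_eq (n := 16) (by norm_num)
    ([(32, 4, 4), (-16, 2, 6), (24, 5, 2), (-24, 1, 6), (7, 4, 2), (-34, 2, 4), (-9, 0, 6),
     (-28, 3, 2), (4, 1, 4), (8, 2, 2), (12, 0, 4), (8, 1, 2), (-4, 0, 2)])
    (by decide) (quadratic_mem_sq
      (z^3) 0 0 0 0 0 0 0 0 0) ?_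
  simp only [List.map_cons, List.map_nil, List.sum_cons, List.sum_nil, mon, g₀, g₁, g₂, g₃,
    Nat.reduceSub]
  push_cast
  ring

lemma mon_mem_reducible {a b : ℕ} (h : a + b ≤ 9) : mon a b ∈ reducible := by
  by_cases hs : (a, b) ∈ stdExponents
  · exact Submodule.mem_sup_left (mon_mem_stdSpan hs)
  · have ha : a < 10 := by omega
    have hb : b < 10 := by omega
    simp only [stdExponents, Finset.mem_filter, Finset.mem_product, Finset.mem_range, ha, hb, h,
      true_and, not_not, Finset.mem_insert, Finset.mem_singleton, Prod.mk.injEq] at hs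
    rcases hs with h | h | h | h | h | h | h | h | h | h <;> obtain ⟨rfl, rfl⟩ := h
    exacts [mon_8_1_mem_reducible, mon_7_2_mem_reducible, mon_6_3_mem_reducible,
      mon_5_4_mem_reducible, mon_4_5_mem_reducible, mon_3_6_mem_reducible,
      mon_2_7_mem_reducible, mon_1_8_mem_reducible, mon_7_1_mem_reducible,
      mon_6_2_mem_reducible]

lemma mul_z_sq_mem_reducible {G : MvPolynomial (Fin 3) ℚ} (hG : G.IsHomogeneous 9) :
    G * z ^ 2 ∈ reducible := by
  rw [G.as_sum, Finset.sum_mul]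
  refine sum_mem fun d hd ↦ ?_
  have hsum := exponents_sum hG hd
  have e : monomial d (G.coeff d) * z ^ 2 = G.coeff d • mon (d 0) (d 1) := by
    rw [monomial_eq_xyz, mon, show 11 - d 0 - d 1 = d 2 + 2 by omega, smul_eq_C_mul]
    ring
  rw [e]
  exact Submodule.smul_mem _ _ (mon_mem_reducible (by omega))

/-- Every form of degree at least eleven is, modulo the square of `I₁₁`, a combination of
multiples of standard monomials by a power of `z`. -/
lemma exists_stdSpan_sub_mem (s : ℕ) {F : MvPolynomial (Fin 3) ℚ}
    (hF : F.IsHomogeneous (s + 11)) : ∃ w ∈ stdSpan, F - w * z ^ s ∈ I₁₁ ^ 2 := by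
  obtain ⟨G, hG, h⟩ := exists_sub_z_pow_mul_mem (s + 2) (F := F) (by
    rwa [show 9 + (s + 2) = s + 11 by omega])
  obtain ⟨w, hw, q, hq, hwq⟩ := Submodule.mem_sup.1 (mul_z_sq_mem_reducible hG)
  refine ⟨w, hw, ?_⟩
  have e : F - w * z ^ s = (F - G * z ^ (s + 2)) + z ^ s * q := by
    linear_combination (-z ^ s) * hwq
  rw [e]
  exact add_mem h (Ideal.mul_mem_left _ _ hq)

end StandardMonomials

section Jets

variable {B : Type*} [CommRing B] [Algebra ℚ B] (e : MvPolynomial (Fin 3) ℚ →ₐ[ℚ] B)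

/-- The value of a polynomial and of its first two partial derivatives under `e`. -/
noncomputable def jet : MvPolynomial (Fin 3) ℚ →ₗ[ℚ] B × B × B :=
  e.toLinearMap.prod ((e.toLinearMap ∘ₗ (pderiv (R := ℚ) (0 : Fin 3)).toLinearMap).prod
    (e.toLinearMap ∘ₗ (pderiv (R := ℚ) (1 : Fin 3)).toLinearMap))

lemma jet_apply (F : MvPolynomial (Fin 3) ℚ) :
    jet e F = (e F, e (pderiv 0 F), e (pderiv 1 F)) := rfl

lemma jet_mul (F G : MvPolynomial (Fin 3) ℚ) :
    jet e (F * G) = (e F * e G, e F * e (pderiv 0 G) + e G * e (pderiv 0 F),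
      e F * e (pderiv 1 G) + e G * e (pderiv 1 F)) := by
  simp only [jet_apply, Derivation.leibniz, smul_eq_mul, map_mul, map_add]

variable {e}

lemma jet_mul_eq_zero {F G : MvPolynomial (Fin 3) ℚ} (hF : e F = 0) (hG : e G = 0) :
    jet e (F * G) = 0 := by
  simp [jet_mul, hF, hG]

lemma jet_mul_eq_of_jet_eq_one {F : MvPolynomial (Fin 3) ℚ} (hF : jet e F = (1, 0, 0))
    (G : MvPolynomial (Fin 3) ℚ) : jet e (F * G) = jet e G := by
  simp only [jet_apply, Prod.mk.injEq] at hF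
  simp [jet_apply, hF]

lemma jet_mul_eq_zero_of_jet_eq_zero {F : MvPolynomial (Fin 3) ℚ} (hF : jet e F = 0)
    (G : MvPolynomial (Fin 3) ℚ) : jet e (F * G) = 0 := by
  simp only [jet_apply, Prod.mk_eq_zero] at hF
  simp [jet_mul, hF]

lemma jet_eq_zero_of_mem_sq {I : Ideal (MvPolynomial (Fin 3) ℚ)} (hI : ∀ p ∈ I, e p = 0)
    {F : MvPolynomial (Fin 3) ℚ} (hF : F ∈ I ^ 2) : jet e F = 0 := by
  rw [pow_two] at hF
  refine Submodule.mul_induction_on hF (fun p hp q hq ↦ jet_mul_eq_zero (hI p hp) (hI q hq))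
    fun p q hp hq ↦ ?_
  rw [map_add, hp, hq, add_zero]

lemma jet_mul_z_pow (hz : e z = 1) (F : MvPolynomial (Fin 3) ℚ) (k : ℕ) :
    jet e (F * z ^ k) = jet e F := by
  have h : jet e z = (1, 0, 0) := by
    rw [jet_apply, hz]
    simp [z]
  induction k with
  | zero => rw [pow_zero, mul_one]
  | succ k ih => rw [pow_succ', mul_left_comm, jet_mul_eq_of_jet_eq_one h, ih]

lemma jet_surjective (he : Function.Surjective e) {u v : MvPolynomial (Fin 3) ℚ}
    (hu : e u = 0) (hu' : IsUnit (e (pderiv 0 u))) (hv : e v = 0) (hv₀ : e (pderiv 0 v) = 0)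
    (hv₁ : IsUnit (e (pderiv 1 v))) : Function.Surjective (jet e) := by
  rintro ⟨b, b₀, b₁⟩
  obtain ⟨α, hα⟩ := hu'.exists_right_inv
  obtain ⟨β, hβ⟩ := hv₁.exists_right_inv
  obtain ⟨F, rfl⟩ := he b
  obtain ⟨G, hG⟩ := he (α * (b₀ - e (pderiv 0 F)))
  obtain ⟨H, hH⟩ := he (β * (b₁ - e (pderiv 1 F) - e G * e (pderiv 1 u)))
  refine ⟨F + G * u + H * v, ?_⟩
  rw [map_add, map_add, jet_mul, jet_mul, jet_apply]
  simp only [Prod.mk_add_mk, hu, hv, hv₀, Prod.mk.injEq, mul_zero, zero_mul, add_zero,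
    true_and]
  refine ⟨?_, ?_⟩
  · rw [hG]
    linear_combination (b₀ - e (pderiv 0 F)) * hα
  · rw [hH]
    linear_combination (b₁ - e (pderiv 1 F) - e G * e (pderiv 1 u)) * hβ

end Jets

section Points

/-- The abscissas of the triple points on the line `y = 0`. -/
noncomputable def axisPoly : Polynomial ℚ :=
  .X ^ 5 - 4 * .X ^ 4 + 2 * .X ^ 3 + 5 * .X ^ 2 - 2 * .X - 1

/-- The ordinates of the triple points off the line `y = 0`. -/
noncomputable def offPoly : Polynomial ℚ :=
  1024 * .X ^ 10 - 8448 * .X ^ 8 + 23232 * .X ^ 6 - 25168 * .X ^ 4 + 10648 * .X ^ 2 - 1331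

/-- The polynomial interpolating, up to the factor `5566`, the abscissas of the triple points
off the line `y = 0` in terms of their ordinates. -/
noncomputable def offAbscissa : Polynomial ℚ :=
  10043 - 18876 * .X ^ 2 + 3168 * .X ^ 4 + 2112 * .X ^ 6 - 512 * .X ^ 8

lemma natDegree_axisPoly : axisPoly.natDegree = 5 := by
  unfold axisPoly
  compute_degree!

lemma natDegree_offPoly : offPoly.natDegree = 10 := by
  unfold offPoly
  compute_degree!

section Aeval

variable {A : Type*} [CommRing A] [Algebra ℚ A] (b : A)

lemma aeval_axisPoly :
    Polynomial.aeval b axisPoly = b ^ 5 - 4 * b ^ 4 + 2 * b ^ 3 + 5 * b ^ 2 - 2 * b - 1 := by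
  simp only [axisPoly, map_add, map_sub, map_mul, map_pow, Polynomial.aeval_X, map_one]
  simp only [map_ofNat]

lemma aeval_offPoly :
    Polynomial.aeval b offPoly = 1024 * b ^ 10 - 8448 * b ^ 8 + 23232 * b ^ 6 - 25168 * b ^ 4
      + 10648 * b ^ 2 - 1331 := by
  simp only [offPoly, map_add, map_sub, map_mul, map_pow, Polynomial.aeval_X]
  simp only [map_ofNat]

lemma aeval_offAbscissa :
    Polynomial.aeval b offAbscissa =
      10043 - 18876 * b ^ 2 + 3168 * b ^ 4 + 2112 * b ^ 6 - 512 * b ^ 8 := by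
  simp only [offAbscissa, map_add, map_sub, map_mul, map_pow, Polynomial.aeval_X]
  simp only [map_ofNat]

lemma aeval_derivative_axisPoly :
    Polynomial.aeval b axisPoly.derivative = 5 * b ^ 4 - 16 * b ^ 3 + 6 * b ^ 2 + 10 * b - 2 := by
  simp only [axisPoly, Polynomial.derivative_mul, Polynomial.derivative_X_pow,
    Polynomial.derivative_X,
    Polynomial.derivative_one, Polynomial.derivative_ofNat, map_add, map_sub, map_mul, map_pow,
    map_zero, map_one, Polynomial.aeval_C, Polynomial.aeval_X, Nat.cast_ofNat]
  simp only [map_ofNat]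
  ring

lemma aeval_derivative_offPoly :
    Polynomial.aeval b offPoly.derivative =
      10240 * b ^ 9 - 67584 * b ^ 7 + 139392 * b ^ 5 - 100672 * b ^ 3 + 21296 * b := by
  simp only [offPoly, Polynomial.derivative_mul, Polynomial.derivative_X_pow,
    Polynomial.derivative_ofNat, map_add, map_sub, map_mul, map_pow,
    map_zero, Polynomial.aeval_C, Polynomial.aeval_X, Nat.cast_ofNat]
  simp only [map_ofNat]
  ring

lemma isUnit_natCast {n : ℕ} (hn : n ≠ 0) : IsUnit (n : A) := by
  rw [← map_natCast (algebraMap ℚ A)]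
  exact (IsUnit.mk0 _ (Nat.cast_ne_zero.2 hn)).map _

variable {b}

lemma isUnit_aeval_derivative_axisPoly (hb : Polynomial.aeval b axisPoly = 0) :
    IsUnit (Polynomial.aeval b axisPoly.derivative) := by
  rw [aeval_axisPoly] at hb
  refine isUnit_of_mul_isUnit_left (y := 2 * b ^ 4 - 7 * b ^ 3 + 2 * b ^ 2 + 7 * b - 1) ?_
  convert isUnit_natCast (A := A) (n := 11) (by norm_num) using 1
  rw [aeval_derivative_axisPoly]
  push_cast
  linear_combination (10 * b ^ 3 - 27 * b ^ 2 + 6 * b + 9) * hb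

lemma isUnit_aeval_derivative_offPoly (hb : Polynomial.aeval b offPoly = 0) :
    IsUnit (Polynomial.aeval b offPoly.derivative) := by
  rw [aeval_offPoly] at hb
  refine isUnit_of_mul_isUnit_left
    (y := 207616 * b ^ 9 - 1593152 * b ^ 7 + 3807760 * b ^ 5 - 3015804 * b ^ 3 + 626659 * b) ?_
  convert isUnit_natCast (A := A) (n := 170391958) (by norm_num) using 1
  rw [aeval_derivative_offPoly]
  push_cast
  linear_combination
    (2076160 * b ^ 8 - 12505856 * b ^ 6 + 21211168 * b ^ 4 - 9002400 * b ^ 2 + 128018) * hb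

lemma gens_eq_zero_on_axis (hb : Polynomial.aeval b axisPoly = 0) :
    g₀ b 0 1 = 0 ∧ g₁ b 0 1 = 0 ∧ g₂ b 0 1 = 0 ∧ g₃ b 0 1 = 0 := by
  rw [aeval_axisPoly] at hb
  unfold g₀ g₁ g₂ g₃
  exact ⟨by ring, by ring, by ring, by linear_combination 2 * hb⟩

lemma gens_eq_zero_off_axis (hb : Polynomial.aeval b offPoly = 0) {a : A}
    (ha : 5566 * a = Polynomial.aeval b offAbscissa) :
    g₀ a b 1 = 0 ∧ g₁ a b 1 = 0 ∧ g₂ a b 1 = 0 ∧ g₃ a b 1 = 0 := by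
  rw [aeval_offPoly] at hb
  rw [aeval_offAbscissa] at ha
  have key {p : A} {n : ℕ} (hp : (5566 : A) ^ n * p = 0) : p = 0 :=
    eq_zero_of_natCast_mul_eq_zero (n := 5566 ^ n) (by positivity) (by push_cast; exact hp)
  refine ⟨key (n := 4) ?_, key (n := 5) ?_, key (n := 5) ?_, key (n := 5) ?_⟩
  · rw [← g₀_scale, ha]
    unfold g₀
    linear_combination (-2918187008 * b ^ 15 + 12037521408 * b ^ 13 + 70720438272 * b ^ 11
      - 326204291072 * b ^ 9 - 572236808704 * b ^ 7 + 2953381582976 * b ^ 5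
      + 1613774825872 * b ^ 3 - 8740974095172 * b) * hb
  · rw [← g₁_scale, ha]
    unfold g₁
    linear_combination (1456744916318208 * b ^ 7 - 26289693411680160 * b ^ 3
      - 41541888557662856 * b) * hb
  · rw [← g₂_scale, ha]
    unfold g₂
    linear_combination (1412601130975232 * b ^ 9 + 485581638772736 * b ^ 7
      - 25493036035568640 * b ^ 5 - 8095556383914208 * b ^ 3 + 103886018648218664 * b) * hb
  · rw [← g₃_scale, ha]
    unfold g₃
    linear_combination (-68719476736 * b ^ 30 + 850403524608 * b ^ 28 - 992137445376 * b ^ 26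
      - 28680449425408 * b ^ 24 + 111536660021248 * b ^ 22 + 306656032325632 * b ^ 20
      - 2225928913027072 * b ^ 18 - 144938212655104 * b ^ 16 + 19886317444595712 * b ^ 14
      - 19798116170072064 * b ^ 12 - 85493393123725312 * b ^ 10 + 136848813961418240 * b ^ 8
      + 145701730019957760 * b ^ 6 - 291899723142754144 * b ^ 4 - 7371287456275600 * b ^ 2
      - 1170399918977762) * hb

end Aeval

/-- Evaluation at the triple points on the line `y = 0`. -/
noncomputable def axisEval : MvPolynomial (Fin 3) ℚ →ₐ[ℚ] AdjoinRoot axisPoly :=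
  aeval ![AdjoinRoot.root axisPoly, 0, 1]

/-- Evaluation at the triple points off the line `y = 0`. -/
noncomputable def offEval : MvPolynomial (Fin 3) ℚ →ₐ[ℚ] AdjoinRoot offPoly :=
  aeval ![(5566 : ℚ)⁻¹ • Polynomial.aeval (AdjoinRoot.root offPoly) offAbscissa,
    AdjoinRoot.root offPoly, 1]

lemma axisEval_x : axisEval x = AdjoinRoot.root axisPoly := by simp [axisEval, x]

lemma axisEval_y : axisEval y = 0 := by simp [axisEval, y]

lemma axisEval_z : axisEval z = 1 := by simp [axisEval, z]

lemma offEval_x : offEval x =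
    (5566 : ℚ)⁻¹ • Polynomial.aeval (AdjoinRoot.root offPoly) offAbscissa := by
  simp [offEval, x]

lemma offEval_y : offEval y = AdjoinRoot.root offPoly := by simp [offEval, y]

lemma offEval_z : offEval z = 1 := by simp [offEval, z]

lemma aeval_root_self (f : Polynomial ℚ) : Polynomial.aeval (AdjoinRoot.root f) f = 0 := by
  rw [AdjoinRoot.aeval_eq, AdjoinRoot.mk_self]

lemma map_eq_zero_of_mem_I₁₁ {A : Type*} [CommRing A] [Algebra ℚ A]
    (e : MvPolynomial (Fin 3) ℚ →ₐ[ℚ] A) (h : g₀ (e x) (e y) (e z) = 0 ∧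
      g₁ (e x) (e y) (e z) = 0 ∧ g₂ (e x) (e y) (e z) = 0 ∧ g₃ (e x) (e y) (e z) = 0)
    {p : MvPolynomial (Fin 3) ℚ} (hp : p ∈ I₁₁) : e p = 0 := by
  obtain ⟨h₀, h₁, h₂, h₃⟩ := h
  have hle : I₁₁.map (e : MvPolynomial (Fin 3) ℚ →+* A) ≤ ⊥ :=
    map_mem_of_mem_I₁₁ _ h₀ h₁ h₂ h₃
  exact (Submodule.mem_bot A).1 (hle (Ideal.mem_map_of_mem _ hp))

lemma axisEval_eq_zero_of_mem {p : MvPolynomial (Fin 3) ℚ} (hp : p ∈ I₁₁) : axisEval p = 0 := by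
  refine map_eq_zero_of_mem_I₁₁ _ ?_ hp
  rw [axisEval_x, axisEval_y, axisEval_z]
  exact gens_eq_zero_on_axis (aeval_root_self _)

lemma offEval_eq_zero_of_mem {p : MvPolynomial (Fin 3) ℚ} (hp : p ∈ I₁₁) : offEval p = 0 := by
  refine map_eq_zero_of_mem_I₁₁ _ ?_ hp
  rw [offEval_y, offEval_z]
  refine gens_eq_zero_off_axis (aeval_root_self _) ?_
  rw [offEval_x, Algebra.smul_def, ← mul_assoc, ← map_ofNat (algebraMap ℚ _), ← map_mul]
  norm_num

lemma eval_surjective_of_root {f : Polynomial ℚ}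
    {e : MvPolynomial (Fin 3) ℚ →ₐ[ℚ] AdjoinRoot f} {u : MvPolynomial (Fin 3) ℚ}
    (hu : e u = AdjoinRoot.root f) : Function.Surjective e := by
  intro b
  obtain ⟨p, rfl⟩ := AdjoinRoot.mk_surjective b
  exact ⟨Polynomial.aeval u p, by rw [← Polynomial.aeval_algHom_apply, hu, AdjoinRoot.aeval_eq]⟩

lemma pderiv_zero_x : pderiv 0 x = 1 := pderiv_X_self 0

lemma pderiv_zero_y : pderiv 0 y = 0 := pderiv_X_of_ne (by decide)

lemma pderiv_one_y : pderiv 1 y = 1 := pderiv_X_self 1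

lemma jet_axisEval_surjective : Function.Surjective (jet axisEval) := by
  refine jet_surjective (eval_surjective_of_root axisEval_x) (u := Polynomial.aeval x axisPoly)
    (v := y) ?_ ?_ axisEval_y ?_ ?_
  · rw [← Polynomial.aeval_algHom_apply, axisEval_x, aeval_root_self]
  · rw [Derivation.map_aeval, pderiv_zero_x, smul_eq_mul, mul_one,
      ← Polynomial.aeval_algHom_apply, axisEval_x]
    exact isUnit_aeval_derivative_axisPoly (aeval_root_self _)
  · rw [pderiv_zero_y, map_zero]
  · rw [pderiv_one_y, map_one]
    exact isUnit_one

lemma offEval_aeval_offPoly : offEval (Polynomial.aeval y offPoly) = 0 := by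
  rw [← Polynomial.aeval_algHom_apply, offEval_y, aeval_root_self]

lemma jet_offEval_surjective : Function.Surjective (jet offEval) := by
  refine jet_surjective (eval_surjective_of_root offEval_y)
    (u := x - (5566 : ℚ)⁻¹ • Polynomial.aeval y offAbscissa)
    (v := Polynomial.aeval y offPoly) ?_ ?_ offEval_aeval_offPoly ?_ ?_
  · rw [map_sub, map_smul, ← Polynomial.aeval_algHom_apply, offEval_x, offEval_y, sub_self]
  · rw [map_sub, Derivation.map_smul, Derivation.map_aeval, pderiv_zero_x, pderiv_zero_y, smul_zero,
      smul_zero, sub_zero, map_one]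
    exact isUnit_one
  · rw [Derivation.map_aeval, pderiv_zero_y, smul_zero, map_zero]
  · rw [Derivation.map_aeval, pderiv_one_y, smul_eq_mul, mul_one,
      ← Polynomial.aeval_algHom_apply, offEval_y]
    exact isUnit_aeval_derivative_offPoly (aeval_root_self _)

/-- A polynomial with jet `1` at the triple points on the line `y = 0` and with zero jet at the
other triple points. -/
noncomputable def axisIndicator : MvPolynomial (Fin 3) ℚ :=
  C (1331⁻¹ ^ 2) * (Polynomial.aeval y offPoly * Polynomial.aeval y offPoly)

lemma jet_offEval_axisIndicator : jet offEval axisIndicator = 0 := by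
  rw [axisIndicator, C_mul', map_smul,
    jet_mul_eq_zero offEval_aeval_offPoly offEval_aeval_offPoly, smul_zero]

lemma jet_axisEval_axisIndicator : jet axisEval axisIndicator = (1, 0, 0) := by
  have h : axisEval (Polynomial.aeval y offPoly) = -1331 := by
    rw [← Polynomial.aeval_algHom_apply, axisEval_y, aeval_offPoly]
    ring
  have h' : axisEval (Polynomial.aeval y offPoly.derivative) = 0 := by
    rw [← Polynomial.aeval_algHom_apply, axisEval_y, aeval_derivative_offPoly]
    ring
  rw [axisIndicator, C_mul', map_smul, jet_mul, Derivation.map_aeval, Derivation.map_aeval,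
    pderiv_zero_y, pderiv_one_y, smul_zero, map_zero, smul_eq_mul, mul_one, h', h, mul_zero,
    add_zero, neg_mul_neg]
  have h₁ : (1331⁻¹ ^ 2 : ℚ) • (1331 * 1331 : AdjoinRoot axisPoly) = 1 := by
    rw [Algebra.smul_def, ← map_ofNat (algebraMap ℚ (AdjoinRoot axisPoly)), ← map_mul, ← map_mul]
    norm_num
  simp only [Prod.smul_mk, h₁, smul_zero]

/-- Values and first derivatives at all triple points. -/
noncomputable def jets : MvPolynomial (Fin 3) ℚ →ₗ[ℚ]
    (AdjoinRoot axisPoly × AdjoinRoot axisPoly × AdjoinRoot axisPoly) ×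
      (AdjoinRoot offPoly × AdjoinRoot offPoly × AdjoinRoot offPoly) :=
  (jet axisEval).prod (jet offEval)

lemma jets_surjective : Function.Surjective jets := by
  rintro ⟨a, b⟩
  obtain ⟨F, rfl⟩ := jet_axisEval_surjective a
  obtain ⟨G, rfl⟩ := jet_offEval_surjective b
  refine ⟨axisIndicator * F + (G - axisIndicator * G), ?_⟩
  simp only [jets, LinearMap.prod_apply, Function.prod, map_add, map_sub,
    jet_mul_eq_of_jet_eq_one jet_axisEval_axisIndicator,
    jet_mul_eq_zero_of_jet_eq_zero jet_offEval_axisIndicator, Prod.mk_add_mk,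
    Prod.mk_sub_mk, sub_self, sub_zero, add_zero, zero_add]

lemma jets_eq_zero_of_mem_sq {F : MvPolynomial (Fin 3) ℚ} (hF : F ∈ I₁₁ ^ 2) : jets F = 0 :=
  Prod.ext (jet_eq_zero_of_mem_sq (fun _ ↦ axisEval_eq_zero_of_mem) hF)
    (jet_eq_zero_of_mem_sq (fun _ ↦ offEval_eq_zero_of_mem) hF)

lemma jets_mul_z_pow (F : MvPolynomial (Fin 3) ℚ) (k : ℕ) : jets (F * z ^ k) = jets F :=
  Prod.ext (jet_mul_z_pow axisEval_z F k) (jet_mul_z_pow offEval_z F k)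

/-- The jet of a combination of standard monomials. -/
noncomputable def stdJets : stdSpan →ₗ[ℚ]
    (AdjoinRoot axisPoly × AdjoinRoot axisPoly × AdjoinRoot axisPoly) ×
      (AdjoinRoot offPoly × AdjoinRoot offPoly × AdjoinRoot offPoly) :=
  jets.domRestrict stdSpan

lemma jets_eq_of_sub_mem {F w : MvPolynomial (Fin 3) ℚ} {s : ℕ}
    (h : F - w * z ^ s ∈ I₁₁ ^ 2) : jets F = jets w := by
  rw [← sub_eq_zero, ← jets_mul_z_pow w s, ← map_sub, jets_eq_zero_of_mem_sq h]

lemma stdJets_surjective : Function.Surjective stdJets := by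
  rw [← LinearMap.range_eq_top, eq_top_iff]
  rintro v -
  obtain ⟨F, rfl⟩ := jets_surjective v
  rw [← sum_homogeneousComponent F, map_sum]
  refine sum_mem fun t _ ↦ ?_
  have hz : (homogeneousComponent t F * z ^ 11).IsHomogeneous (t + 11) := by
    simpa [z] using (homogeneousComponent_isHomogeneous t F).mul ((isHomogeneous_X ℚ 2).pow 11)
  obtain ⟨w, hw, h⟩ := exists_stdSpan_sub_mem t hz
  refine ⟨⟨w, hw⟩, ?_⟩
  rw [← jets_mul_z_pow _ 11, jets_eq_of_sub_mem h]
  rfl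

lemma finrank_adjoinRoot {f : Polynomial ℚ} (hf : f ≠ 0) :
    Module.Finite ℚ (AdjoinRoot f) ∧ Module.finrank ℚ (AdjoinRoot f) = f.natDegree :=
  ⟨(AdjoinRoot.powerBasis hf).finite,
    by rw [(AdjoinRoot.powerBasis hf).finrank, AdjoinRoot.powerBasis_dim]⟩

lemma stdJets_injective : Function.Injective stdJets := by
  have : Module.Finite ℚ stdSpan := FiniteDimensional.span_finset ℚ _
  have h₁ : axisPoly ≠ 0 := Polynomial.ne_zero_of_natDegree_gt (n := 0) (by
    rw [natDegree_axisPoly]; norm_num)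
  have h₂ : offPoly ≠ 0 := Polynomial.ne_zero_of_natDegree_gt (n := 0) (by
    rw [natDegree_offPoly]; norm_num)
  obtain ⟨f₁, r₁⟩ := finrank_adjoinRoot h₁
  obtain ⟨f₂, r₂⟩ := finrank_adjoinRoot h₂
  refine (LinearMap.injective_iff_surjective_of_finrank_eq_finrank ?_).2 stdJets_surjective
  refine le_antisymm (finrank_stdSpan_le.trans_eq ?_)
    (LinearMap.finrank_le_finrank_of_surjective stdJets_surjective)
  simp only [Module.finrank_prod, r₁, r₂, natDegree_axisPoly, natDegree_offPoly]

/-- A form of degree at least eleven vanishing to order two at the triple points lies in the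
square of `I₁₁`. -/
lemma mem_sq_of_eleven_le {t k : ℕ} (ht : 11 ≤ t) {F : MvPolynomial (Fin 3) ℚ}
    (hF : F.IsHomogeneous t) (hFz : F * z ^ k ∈ I₁₁ ^ 2) : F ∈ I₁₁ ^ 2 := by
  obtain ⟨s, rfl⟩ := Nat.exists_eq_add_of_le' ht
  obtain ⟨w, hw, h⟩ := exists_stdSpan_sub_mem s hF
  have h0 : stdJets ⟨w, hw⟩ = 0 := by
    rw [stdJets, LinearMap.domRestrict_apply, ← jets_eq_of_sub_mem h, ← jets_mul_z_pow F k,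
      jets_eq_zero_of_mem_sq hFz]
  have hw0 : (⟨w, hw⟩ : stdSpan) = 0 := stdJets_injective (h0.trans (map_zero _).symm)
  obtain rfl : w = 0 := congrArg Subtype.val hw0
  simpa using h

end Points

lemma symbolic_cube_le_sq {t k : ℕ} {F : MvPolynomial (Fin 3) ℚ} (hF : F.IsHomogeneous t)
    (hFz : F * z ^ k ∈ I₁₁ ^ 3) : F ∈ I₁₁ ^ 2 := by
  rcases le_or_gt t 10 with ht | ht
  · rw [eq_zero_of_degree_le_ten hF ht hFz]
    exact zero_mem _
  · exact mem_sq_of_eleven_le ht hF (Ideal.pow_le_pow_right (by norm_num) hFz)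

end Boroczky

/-- For the radical ideal `I` of the triple points of the Böröczky arrangement of `11`
lines, the saturation of `I³` with respect to the irrelevant ideal `⟨x, y, z⟩`, i.e. the
third symbolic power `I⁽³⁾`, is contained in `I²`. -/
theorem containment_boroczky_11 :
    ∀ F : MvPolynomial (Fin 3) ℚ,
      (∃ k : ℕ, Ideal.span {F} * (Ideal.span {x, y, z}) ^ k ≤ I₁₁ ^ 3) → F ∈ I₁₁ ^ 2 := by
  intro F ⟨k, hk⟩
  exact Boroczky.saturation_le_of_homogeneous
    (fun _ _ _ hF hFz ↦ Boroczky.symbolic_cube_le_sq hF hFz) F k hk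
end

section
/- Let I ⊆ ℚ[x,y,z] be the ideal generated by the four polynomials 4x³y − 4xy³ − 3x²yz − 3y³z − 2xyz² + 2yz³, 32y⁵ + 88xy³z + 33x²yz² − 55y³z² − 66xyz³ + 22yz⁴, 32x²y³ + 72xy³z + 11x²yz² + 35y³z² − 22xyz³ − 22yz⁴, and 2x⁵ − 10xy⁴ − 8x⁴z − 15x²y²z − 7y⁴z + 4x³z² + 2xy²z² + 10x²z³ + 8y²z³ − 4xz⁴ − 2z⁵ (the radical ideal of the triple intersection points of the Böröczky arrangement of 11 lines), and let J be the saturation of I³ with respect to ⟨x,y,z⟩ (the third symbolic power I^{(3)}). Then the initial degree α(J) equals 11: every nonzero homogeneous element of J has degree at least 11, and J contains a nonzero homogeneous element of degree exactly 11. -/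
/-- Membership in the saturation `J = (I₁₁³ : ⟨x,y,z⟩^∞)`, i.e. in the third symbolic
power `I₁₁⁽³⁾`. -/
def memSat (F : MvPolynomial (Fin 3) ℚ) : Prop :=
  ∃ k : ℕ, Ideal.span {F} * (Ideal.span {x, y, z}) ^ k ≤ I₁₁ ^ 3

open Polynomial in
/-- A polynomial of degree at most `10` with four distinct triple roots vanishes. -/
theorem eq_zero_of_four_triple_roots {p : ℂ[X]} (hp : p.natDegree ≤ 10) {σ : Fin 4 → ℂ}
    (hσ : Function.Injective σ) (h : ∀ i, (X - C (σ i)) ^ 3 ∣ p) : p = 0 := by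
  by_contra hne
  have hdvd : ∏ i, (X - C (σ i)) ^ 3 ∣ p :=
    Fintype.prod_dvd_of_coprime
      (fun i j hij => (pairwise_coprime_X_sub_C hσ hij).pow) h
  have hdeg := natDegree_le_of_dvd hdvd hne
  rw [Polynomial.natDegree_prod_of_monic _ _ fun i _ => (monic_X_sub_C _).pow 3] at hdeg
  simp at hdeg
  omega

section ConjugateCoordinates

variable {A : Type*} [CommRing A] [Algebra ℂ A]

/-- Substitution of the affine point with conjugate coordinates `w = x + iy`, `s = x - iy`
in the chart `z = 1`. -/
noncomputable def conjSubst (w s : A) : MvPolynomial (Fin 3) ℚ →+* A :=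
  MvPolynomial.eval₂Hom ((algebraMap ℂ A).comp (algebraMap ℚ ℂ))
    ![(2⁻¹ : ℂ) • (w + s), (-Complex.I / 2) • (w - s), 1]

theorem conjSubst_x (w s : A) : conjSubst w s x = (2⁻¹ : ℂ) • (w + s) := by
  simp [conjSubst, x]

theorem conjSubst_y (w s : A) : conjSubst w s y = (-Complex.I / 2) • (w - s) := by
  simp [conjSubst, y]

theorem conjSubst_z (w s : A) : conjSubst w s z = 1 := by
  simp [conjSubst, z]

theorem map_conjSubst {B : Type*} [CommRing B] [Algebra ℂ B] (f : A →ₐ[ℂ] B) (w s : A)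
    (F : MvPolynomial (Fin 3) ℚ) : f (conjSubst w s F) = conjSubst (f w) (f s) F := by
  suffices h : (f : A →+* B).comp (conjSubst w s) = conjSubst (f w) (f s) from
    RingHom.congr_fun h F
  refine MvPolynomial.ringHom_ext (fun r => ?_) fun i => ?_
  · simp [conjSubst]
  · fin_cases i <;> simp [conjSubst]

open Polynomial in
theorem natDegree_conjSubst_le {w s : A[X]} (hw : w.natDegree ≤ 1) (hs : s.natDegree ≤ 1)
    {F : MvPolynomial (Fin 3) ℚ} {n : ℕ} (hF : F.totalDegree ≤ n) :
    (conjSubst w s F).natDegree ≤ n := by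
  let φ : ℚ →+* A := (algebraMap ℂ A).comp (algebraMap ℚ ℂ)
  have key : conjSubst w s F = MvPolynomial.aeval
      ![(2⁻¹ : ℂ) • (w + s), (-Complex.I / 2) • (w - s), 1] (MvPolynomial.map φ F) := by
    rw [conjSubst, MvPolynomial.coe_eval₂Hom, MvPolynomial.aeval_def, MvPolynomial.eval₂_map]
    congr 1
  rw [key]
  have hdeg : (MvPolynomial.map φ F).totalDegree ≤ n :=
    (Finset.sup_mono (MvPolynomial.support_map_subset φ F)).trans hF
  refine (MvPolynomial.aeval_natDegree_le (m := n) (n := 1) _ hdeg _ fun i => ?_).trans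
    (mul_one n).le
  fin_cases i
  · exact (natDegree_smul_le _ _).trans (natDegree_add_le_of_degree_le hw hs)
  · exact (natDegree_smul_le _ _).trans (natDegree_sub_le_of_le hw hs)
  · simp

end ConjugateCoordinates

theorem mem_cube_of_memSat {F : MvPolynomial (Fin 3) ℚ} (hF : memSat F) :
    ∃ k : ℕ, F * z ^ k ∈ I₁₁ ^ 3 := by
  obtain ⟨k, hk⟩ := hF
  exact ⟨k, hk (Ideal.mul_mem_mul (Ideal.mem_span_singleton_self F)
    (Ideal.pow_mem_pow (Ideal.subset_span (by simp)) k))⟩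

open Polynomial in
/-- Along a line through a triple point, elements of the symbolic cube have a triple root. -/
theorem triple_root_of_memSat {F : MvPolynomial (Fin 3) ℚ} (hF : memSat F) {w : ℂ[X]} {a : ℂ}
    (h : I₁₁ ≤ RingHom.ker (conjSubst (w.eval a) a)) :
    (X - C a) ^ 3 ∣ conjSubst w X F := by
  obtain ⟨k, hk⟩ := mem_cube_of_memSat hF
  have hI : I₁₁.map (conjSubst w X) ≤ Ideal.span {X - C a} := by
    rw [Ideal.map_le_iff_le_comap]
    intro f hf
    have hev := map_conjSubst (Polynomial.aeval a : ℂ[X] →ₐ[ℂ] ℂ) w X f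
    simp only [Polynomial.coe_aeval_eq_eval, Polynomial.eval_X] at hev
    rw [Ideal.mem_comap, Ideal.mem_span_singleton, dvd_iff_isRoot, IsRoot.def, hev]
    exact h hf
  have hmem := Ideal.mem_map_of_mem (conjSubst w X) hk
  rw [Ideal.map_pow, map_mul, map_pow, conjSubst_z, one_pow, mul_one] at hmem
  rw [← Ideal.mem_span_singleton, ← Ideal.span_singleton_pow]
  exact Ideal.pow_right_mono hI 3 hmem

/-- The generators of `I₁₁` at a point of the chart `z = 1`, in conjugate coordinates. -/
theorem le_ker_conjSubst {w s : ℂ}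
    (h₁ : w = s ∨ (s + w) * (s ^ 2 + w ^ 2) - 3 * s * w - (s + w) + 2 = 0)
    (h₂ : w = s ∨ 2 * (w - s) ^ 4 - 11 * (s + w) * (w - s) ^ 2 + 33 / 4 * (s + w) ^ 2
      + 55 / 4 * (w - s) ^ 2 - 33 * (s + w) + 22 = 0)
    (h₃ : w = s ∨ -2 * (s + w) ^ 2 * (w - s) ^ 2 - 9 * (s + w) * (w - s) ^ 2
      + 11 / 4 * (s + w) ^ 2 - 35 / 4 * (w - s) ^ 2 - 11 * (s + w) - 22 = 0)
    (h₄ : 1 / 16 * (s + w) ^ 5 - 5 / 16 * (s + w) * (w - s) ^ 4 - 1 / 2 * (s + w) ^ 4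
      + 15 / 16 * (s + w) ^ 2 * (w - s) ^ 2 - 7 / 16 * (w - s) ^ 4 + 1 / 2 * (s + w) ^ 3
      - 1 / 4 * (s + w) * (w - s) ^ 2 + 5 / 2 * (s + w) ^ 2 - 2 * (w - s) ^ 2
      - 2 * (s + w) - 2 = 0) :
    I₁₁ ≤ RingHom.ker (conjSubst w s) := by
  have hy : ∃ b : ℂ, (-Complex.I / 2) • (w - s) = b ∧ b ^ 2 = -(w - s) ^ 2 / 4 ∧
      (w = s → b = 0) := by
    refine ⟨_, rfl, ?_, fun h => by simp [h]⟩
    rw [smul_eq_mul]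
    linear_combination (w - s) ^ 2 / 4 * Complex.I_sq
  obtain ⟨b, hb, hb2, hb0⟩ := hy
  rw [I₁₁, Ideal.span_le]
  rintro f (rfl | rfl | rfl | rfl) <;>
    simp only [SetLike.mem_coe, RingHom.mem_ker, map_add, map_sub, map_mul, map_pow, map_ofNat,
      conjSubst_x, conjSubst_y, conjSubst_z, hb, smul_eq_mul]
  · rcases h₁ with h | h
    · simp [hb0 h]
    · linear_combination b * h - b * (4 * (2⁻¹ * (w + s)) + 3) * hb2
  · rcases h₂ with h | h
    · simp [hb0 h]
    · linear_combination b * h + b * (32 * (b ^ 2 - (w - s) ^ 2 / 4)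
        + 88 * (2⁻¹ * (w + s)) - 55) * hb2
  · rcases h₃ with h | h
    · simp [hb0 h]
    · linear_combination b * h + b * (32 * (2⁻¹ * (w + s)) ^ 2
        + 72 * (2⁻¹ * (w + s)) + 35) * hb2
  · linear_combination h₄ + ((-10 * (2⁻¹ * (w + s)) - 7) * (b ^ 2 - (w - s) ^ 2 / 4)
        - 15 * (2⁻¹ * (w + s)) ^ 2 + 2 * (2⁻¹ * (w + s)) + 8) * hb2

theorem geom_sum_eleven {η : ℂ} (hη : IsPrimitiveRoot η 11) :
    1 + η + η ^ 2 + η ^ 3 + η ^ 4 + η ^ 5 + η ^ 6 + η ^ 7 + η ^ 8 + η ^ 9 + η ^ 10 = 0 := by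
  simpa [Finset.sum_range_succ] using hη.geom_sum_eq_zero (by norm_num)

/-- The triple points on the axis `y = 0`. -/
theorem le_ker_conjSubst_axis {η : ℂ} (hη : IsPrimitiveRoot η 11) :
    I₁₁ ≤ RingHom.ker (conjSubst (1 + η + η ^ 10) (1 + η + η ^ 10)) := by
  refine le_ker_conjSubst (Or.inl rfl) (Or.inl rfl) (Or.inl rfl) ?_
  linear_combination (2 + 4*η - 12*η^2 - 2*η^3 + 10*η^4 - 2*η^6 + 6*η^10 - 16*η^11 - 8*η^12 + 20*η^13 - 2*η^17 -
      6*η^20 - 12*η^21 + 20*η^22 - 2*η^28 - 8*η^30 + 10*η^31 - 2*η^39 + 2*η^40) * geom_sum_eleven hη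

/-- The triple points off the axis `y = 0`. -/
theorem le_ker_conjSubst_off_axis {η : ℂ} (hη : IsPrimitiveRoot η 11) :
    I₁₁ ≤ RingHom.ker (conjSubst (η ^ 10 + η ^ 9 + η ^ 3) (η + η ^ 2 + η ^ 8)) := by
  refine le_ker_conjSubst (Or.inr ?_) (Or.inr ?_) (Or.inr ?_) ?_
  · linear_combination (2 - 3*η + η^3 + η^5 + 2*η^6 - η^7 - 2*η^8 - η^10 + η^11 + 4*η^12 + 2*η^13 - η^15 - η^16 -
      η^17 + η^18 + 2*η^19 + η^20) * geom_sum_eleven hη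
  · linear_combination (22 - 55*η + 22*η^2 + 11*η^3 - 20*η^4 - 5*η^5 + 62*η^6 - 31*η^7 - 38*η^8 + 48*η^9 - 45*η^10 -
      37*η^11 + 106*η^12 + 38*η^13 - 76*η^14 + 7*η^15 + 19*η^16 - 67*η^17 + 41*η^18 + 84*η^19 -
      43*η^20 - 50*η^21 + 18*η^22 - 4*η^23 - 12*η^24 + 26*η^25 + 6*η^26 - 20*η^27 - 4*η^28 +
      6*η^29 + 2*η^30) * geom_sum_eleven hη
  · linear_combination (-22 + 11*η - 6*η^2 - 15*η^3 + 20*η^4 + 9*η^5 - 6*η^6 + 19*η^7 - 10*η^8 - 24*η^9 + η^10 +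
      17*η^11 - 2*η^12 + 18*η^13 + 12*η^14 - 11*η^15 - 15*η^16 - η^17 + 3*η^18 + 12*η^19 + 15*η^20
      + 2*η^21 - 18*η^22 - 12*η^23 - 4*η^24 + 6*η^25 + 10*η^26 + 4*η^27 - 4*η^28 - 6*η^29 - 2*η^30) * geom_sum_eleven hη
  · linear_combination (-2 + 1/2*η^2 + 3/4*η^3 + 11*η^4 + η^5 - 17/2*η^6 - 5/4*η^7 - 15/2*η^8 - 15/4*η^9 + 31/2*η^10
      + 47/2*η^11 - 53/4*η^12 - 17/2*η^13 - 43/4*η^14 - 87/4*η^15 + 11/4*η^16 + 117/4*η^17 +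
      35/4*η^18 - 17/2*η^19 - 6*η^20 - 101/4*η^21 - 65/4*η^22 + 43/2*η^23 + 21*η^24 + 3*η^25 -
      5/2*η^26 - 21/2*η^27 - 65/4*η^28 + 15/4*η^29 + 69/4*η^30 + 15/2*η^31 - 5/4*η^32 - 5/2*η^33 -
      7/2*η^34 - 3/2*η^35 + 15/4*η^36 + 15/4*η^37 - η^39 - 1/4*η^40) * geom_sum_eleven hη

/-- On a line of the arrangement the triple points are separated by the sum of the two
remaining parameters, whose product is fixed. -/
theorem eq_or_add_eq_of_sum_eq {η : ℂ} (hη : IsPrimitiveRoot η 11) (c : ℂ) {a b n : ℕ}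
    (ha : a < 11 ∧ a ≤ n) (hb : b < 11 ∧ b ≤ n ∧ n < b + 11)
    (h : c + η ^ a + η ^ (n - a) = c + η ^ b + η ^ (n - b)) : a = b ∨ a + b = n := by
  have h1 : η ^ a * η ^ (n - a) = η ^ n := by rw [← pow_add]; congr 1; omega
  have h2 : η ^ b * η ^ (n - b) = η ^ n := by rw [← pow_add]; congr 1; omega
  have h3 : (η ^ a - η ^ b) * (η ^ a - η ^ (n - b)) = 0 := by
    linear_combination η ^ a * h + h2 - h1
  rcases mul_eq_zero.mp h3 with h4 | h4
  · exact Or.inl (hη.pow_inj (by omega) (by omega) (sub_eq_zero.mp h4))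
  · have := hη.pow_inj (by omega) (by omega) (sub_eq_zero.mp h4)
    omega

open Polynomial in
/-- The line of the arrangement with parameter `u` is `w = u s + (u¹⁰ - u²)`. -/
theorem conjSubst_line_eq_zero {F : MvPolynomial (Fin 3) ℚ} (hdeg : F.totalDegree ≤ 10)
    (hF : memSat F) {u : ℂ} {σ : Fin 4 → ℂ} (hσ : Function.Injective σ)
    (h : ∀ i, I₁₁ ≤ RingHom.ker (conjSubst (u * σ i + (u ^ 10 - u ^ 2)) (σ i))) :
    conjSubst (C u * X + C (u ^ 10 - u ^ 2)) X F = 0 := by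
  refine eq_zero_of_four_triple_roots
    (natDegree_conjSubst_le natDegree_linear_le natDegree_X_le hdeg) hσ fun i => ?_
  refine triple_root_of_memSat hF ?_
  simpa using h i

open Polynomial in
theorem conjSubst_axis_eq_zero {F : MvPolynomial (Fin 3) ℚ} (hdeg : F.totalDegree ≤ 10)
    (hF : memSat F) {η : ℂ} (hη : IsPrimitiveRoot η 11) :
    conjSubst (C (1 : ℂ) * X + C ((1 : ℂ) ^ 10 - 1 ^ 2)) X F = 0 := by
  refine conjSubst_line_eq_zero hdeg hF
    (σ := fun i : Fin 4 => 1 + η ^ (i.val + 1) + η ^ (11 - (i.val + 1))) ?_ fun i => ?_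
  · intro i j hij
    have := eq_or_add_eq_of_sum_eq hη 1 (by omega) (by omega) hij
    omega
  · have hi : IsPrimitiveRoot (η ^ (i.val + 1)) 11 :=
      hη.pow_of_coprime _ (by fin_cases i <;> decide)
    have hpow : (η ^ (i.val + 1)) ^ 10 = η ^ (11 - (i.val + 1)) := by
      rw [← pow_mul, pow_eq_pow_mod _ hη.pow_eq_one]
      congr 1
      omega
    have := le_ker_conjSubst_axis hi
    rw [hpow] at this
    simpa using this

open Polynomial in
theorem conjSubst_primitive_line_eq_zero {F : MvPolynomial (Fin 3) ℚ}
    (hdeg : F.totalDegree ≤ 10) (hF : memSat F) {η : ℂ} (hη : IsPrimitiveRoot η 11) :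
    conjSubst (C η * X + C (η ^ 10 - η ^ 2)) X F = 0 := by
  have hone : η ^ 11 = 1 := hη.pow_eq_one
  refine conjSubst_line_eq_zero hdeg hF
    (σ := ![η + 1 + η ^ 10, η + η ^ 2 + η ^ 8, η + η ^ 4 + η ^ 6, η + η ^ 3 + η ^ 7]) ?_ fun i => ?_
  · have hσ : ![η + 1 + η ^ 10, η + η ^ 2 + η ^ 8, η + η ^ 4 + η ^ 6, η + η ^ 3 + η ^ 7] =
        fun i : Fin 4 => η + η ^ (![0, 2, 4, 3] i) + η ^ (10 - ![0, 2, 4, 3] i) := by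
      ext i
      fin_cases i <;> simp
    rw [hσ]
    intro i j hij
    have hb : ∀ k : Fin 4, ![0, 2, 4, 3] k < 11 ∧ ![0, 2, 4, 3] k ≤ 10 ∧
        10 < ![0, 2, 4, 3] k + 11 := by decide
    have hinj : ∀ k l : Fin 4, (![0, 2, 4, 3] k = ![0, 2, 4, 3] l ∨
        ![0, 2, 4, 3] k + ![0, 2, 4, 3] l = 10) → k = l := by decide
    exact hinj i j (eq_or_add_eq_of_sum_eq hη η ⟨(hb i).1, (hb i).2.1⟩ (hb j) hij)
  · have h6 := le_ker_conjSubst_off_axis (hη.pow_of_coprime 6 (by decide))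
    have h7 := le_ker_conjSubst_off_axis (hη.pow_of_coprime 7 (by decide))
    have hcongr : ∀ {w s w' s' : ℂ}, I₁₁ ≤ RingHom.ker (conjSubst w s) → w' = w → s' = s →
        I₁₁ ≤ RingHom.ker (conjSubst w' s') := fun h hw hs => hw ▸ hs ▸ h
    fin_cases i
    · refine hcongr (le_ker_conjSubst_axis hη) ?_ ?_
      · change η * (η + 1 + η ^ 10) + (η ^ 10 - η ^ 2) = 1 + η + η ^ 10
        linear_combination hone
      · change η + 1 + η ^ 10 = 1 + η + η ^ 10
        ring
    · refine hcongr (le_ker_conjSubst_off_axis hη) ?_ ?_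
      · change η * (η + η ^ 2 + η ^ 8) + (η ^ 10 - η ^ 2) = η ^ 10 + η ^ 9 + η ^ 3
        ring
      · rfl
    · refine hcongr h6 ?_ ?_
      · change η * (η + η ^ 4 + η ^ 6) + (η ^ 10 - η ^ 2) = _
        linear_combination -(η ^ 5 * (η ^ 44 + η ^ 33 + η ^ 22 + η ^ 11 + 1)
          + η ^ 10 * (η ^ 33 + η ^ 22 + η ^ 11 + 1) + η ^ 7) * hone
      · change η + η ^ 4 + η ^ 6 = _
        linear_combination -(η + η ^ 4 * (η ^ 33 + η ^ 22 + η ^ 11 + 1)) * hone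
    · refine hcongr h7 ?_ ?_
      · change η * (η + η ^ 3 + η ^ 7) + (η ^ 10 - η ^ 2) = _
        linear_combination -(η ^ 4 * (η ^ 55 + η ^ 44 + η ^ 33 + η ^ 22 + η ^ 11 + 1)
          + η ^ 8 * (η ^ 44 + η ^ 33 + η ^ 22 + η ^ 11 + 1) + η ^ 10) * hone
      · change η + η ^ 3 + η ^ 7 = _
        linear_combination -(η ^ 3 + η * (η ^ 44 + η ^ 33 + η ^ 22 + η ^ 11 + 1)) * hone

theorem eval_smul_of_isHomogeneous {F : MvPolynomial (Fin 3) ℚ} {d : ℕ} (hF : F.IsHomogeneous d)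
    (c : ℚ) (v : Fin 3 → ℚ) :
    MvPolynomial.eval (c • v) F = c ^ d * MvPolynomial.eval v F := by
  rw [MvPolynomial.eval_eq, MvPolynomial.eval_eq, Finset.mul_sum]
  refine Finset.sum_congr rfl fun m hm => ?_
  have hd : m.degree = d := by
    by_contra hne
    exact MvPolynomial.mem_support_iff.mp hm (hF.coeff_eq_zero hne)
  simp only [Pi.smul_apply, smul_eq_mul, mul_pow, Finset.prod_mul_distrib, Finset.prod_pow_eq_pow_sum]
  rw [← hd, Finsupp.degree_apply]
  ring

/-- A form is determined by its values on the chart `z = 1`. -/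
theorem eq_zero_of_conjSubst_eq_zero {F : MvPolynomial (Fin 3) ℚ} {d : ℕ}
    (hF : F.IsHomogeneous d) (h : ∀ w s : ℂ, conjSubst w s F = 0) : F = 0 := by
  have hchart : ∀ a b : ℚ, MvPolynomial.eval ![a, b, 1] F = 0 := by
    intro a b
    have hab := h (a + Complex.I * b) (a - Complex.I * b)
    have hv : (![(2⁻¹ : ℂ) • ((a + Complex.I * b) + (a - Complex.I * b)),
        (-Complex.I / 2) • ((a + Complex.I * b) - (a - Complex.I * b)), 1] : Fin 3 → ℂ)
        = algebraMap ℚ ℂ ∘ ![a, b, 1] := by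
      ext i
      fin_cases i
      · simp
        ring
      · simp
        linear_combination -(b : ℂ) * Complex.I_sq
      · simp
    rw [conjSubst, hv, MvPolynomial.coe_eval₂Hom, Algebra.algebraMap_self, RingHom.id_comp,
      ← MvPolynomial.eval₂_comp, map_eq_zero_iff _ (algebraMap ℚ ℂ).injective] at hab
    exact hab
  have hmul : F * z = 0 := by
    refine MvPolynomial.funext fun v => ?_
    rw [map_mul, z, MvPolynomial.eval_X, map_zero]
    by_cases hv : v 2 = 0
    · simp [hv]
    · have hsmul : v = v 2 • ![v 0 / v 2, v 1 / v 2, 1] := by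
        ext i
        fin_cases i <;> simp <;> field_simp
      rw [hsmul, eval_smul_of_isHomogeneous hF, hchart]
      simp
  exact (mul_eq_zero.mp hmul).resolve_right (MvPolynomial.X_ne_zero 2)

open Polynomial in
theorem eq_zero_of_memSat_of_lt {F : MvPolynomial (Fin 3) ℚ} {d : ℕ} (hd : d < 11)
    (hhom : F.IsHomogeneous d) (hF : memSat F) : F = 0 := by
  have hdeg : F.totalDegree ≤ 10 := hhom.totalDegree_le.trans (by omega)
  have hζ : IsPrimitiveRoot (Complex.exp (2 * Real.pi * Complex.I / (11 : ℕ))) 11 :=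
    Complex.isPrimitiveRoot_exp 11 (by norm_num)
  generalize Complex.exp (2 * Real.pi * Complex.I / (11 : ℕ)) = ζ at hζ
  have hline : ∀ j : Fin 11,
      conjSubst (C (ζ ^ j.val) * X + C ((ζ ^ j.val) ^ 10 - (ζ ^ j.val) ^ 2)) X F = 0 := by
    intro j
    by_cases hj : j.val = 0
    · rw [hj, pow_zero]
      exact conjSubst_axis_eq_zero hdeg hF hζ
    · refine conjSubst_primitive_line_eq_zero hdeg hF (hζ.pow_of_coprime _ ?_)
      exact (Nat.coprime_of_lt_prime hj j.isLt (by norm_num)).symm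
  have hzero : conjSubst (X : ℂ[X][X]) (C X) F = 0 := by
    refine eq_zero_of_natDegree_lt_card_of_eval_eq_zero _
      (f := fun j : Fin 11 => C (ζ ^ j.val) * X + C ((ζ ^ j.val) ^ 10 - (ζ ^ j.val) ^ 2))
      ?_ (fun j => ?_) ?_
    · intro i j hij
      have := congrArg (fun p => p.coeff 1) hij
      simp only [coeff_add, coeff_C_mul, coeff_X_one, coeff_C_succ, mul_one, add_zero] at this
      exact Fin.ext (hζ.pow_inj i.isLt j.isLt this)
    · have := map_conjSubst ((Polynomial.aeval (C (ζ ^ j.val) * X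
        + C ((ζ ^ j.val) ^ 10 - (ζ ^ j.val) ^ 2)) : ℂ[X][X] →ₐ[ℂ[X]] ℂ[X]).restrictScalars ℂ)
        X (C X) F
      rw [← hline j]
      simpa using this
    · have := natDegree_conjSubst_le (A := ℂ[X]) (w := X) (s := C X) natDegree_X_le
        (by simp) hdeg
      simp
      omega
  refine eq_zero_of_conjSubst_eq_zero hhom fun w s => ?_
  have h1 := map_conjSubst ((Polynomial.aeval (C w) : ℂ[X][X] →ₐ[ℂ[X]] ℂ[X]).restrictScalars ℂ)
    X (C X) F
  have h2 := map_conjSubst (Polynomial.aeval s : ℂ[X] →ₐ[ℂ] ℂ) (C w) X F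
  rw [hzero, map_zero] at h1
  simp at h1 h2
  rw [← h2, ← h1]
  simp

/-- The product of the eleven lines of the arrangement, up to sign. -/
def linesProduct {R : Type*} [CommRing R] (x y z : R) : R :=
  -11*x^10*y + 88*x^9*y*z + 165*x^8*y^3 - 220*x^8*y*z^2 - 528*x^7*y^3*z + 66*x^7*y*z^3 -
  462*x^6*y^5 + 440*x^6*y*z^4 + 1078*x^5*y^3*z^3 - 374*x^5*y*z^5 + 330*x^4*y^7 + 616*x^4*y^5*z^2 -
  220*x^4*y^3*z^4 - 275*x^4*y*z^6 + 528*x^3*y^7*z - 154*x^3*y^5*z^3 - 660*x^3*y^3*z^5 +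
  264*x^3*y*z^7 - 55*x^2*y^9 + 352*x^2*y^7*z^2 - 528*x^2*y^5*z^4 + 110*x^2*y^3*z^6 + 66*x^2*y*z^8
  - 88*x*y^9*z + 242*x*y^7*z^3 - 286*x*y^5*z^5 + 176*x*y^3*z^7 - 44*x*y*z^9 + y^11 - 44*y^9*z^2 +
  132*y^7*z^4 - 143*y^5*z^6 + 66*y^3*z^8 - 11*y*z^10

theorem isHomogeneous_linesProduct : (linesProduct x y z).IsHomogeneous 11 := by
  have hx : x.IsHomogeneous 1 := MvPolynomial.isHomogeneous_X ℚ 0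
  have hy : y.IsHomogeneous 1 := MvPolynomial.isHomogeneous_X ℚ 1
  have hz : z.IsHomogeneous 1 := MvPolynomial.isHomogeneous_X ℚ 2
  have hc : ∀ (n : ℕ) [n.AtLeastTwo],
      (OfNat.ofNat n : MvPolynomial (Fin 3) ℚ).IsHomogeneous 0 := fun n _ => by
    rw [← map_ofNat MvPolynomial.C n]
    exact MvPolynomial.isHomogeneous_C _ _
  have hcast : ∀ {p : MvPolynomial (Fin 3) ℚ} {n : ℕ}, p.IsHomogeneous n → n = 11 →
      p.IsHomogeneous 11 := fun hp hn => hn ▸ hp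
  unfold linesProduct
  repeat' first | apply MvPolynomial.IsHomogeneous.add | apply MvPolynomial.IsHomogeneous.sub
  all_goals
    apply hcast
    · repeat' first
        | exact hx | exact hy | exact hz | exact hc _
        | apply MvPolynomial.IsHomogeneous.mul
        | apply MvPolynomial.IsHomogeneous.pow
        | apply MvPolynomial.IsHomogeneous.neg
    · norm_num

theorem linesProduct_ne_zero : linesProduct x y z ≠ 0 := by
  intro h
  have := congrArg (MvPolynomial.eval ![(0 : ℚ), 1, 0]) h
  simp [linesProduct, x, y, z] at this

section Certificates

variable {R : Type*} [CommRing R] (x y z : R) {g₁ g₂ g₃ g₄ : R}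

theorem linesProduct_mul_z_pow
    (h₁ : g₁ = 4*x^3*y - 4*x*y^3 - 3*x^2*y*z - 3*y^3*z - 2*x*y*z^2 + 2*y*z^3)
    (h₂ : g₂ = 32*y^5 + 88*x*y^3*z + 33*x^2*y*z^2 - 55*y^3*z^2 - 66*x*y*z^3 + 22*y*z^4)
    (h₃ : g₃ = 32*x^2*y^3 + 72*x*y^3*z + 11*x^2*y*z^2 + 35*y^3*z^2 - 22*x*y*z^3 - 22*y*z^4)
    (h₄ : g₄ = 2*x^5 - 10*x*y^4 - 8*x^4*z - 15*x^2*y^2*z - 7*y^4*z + 4*x^3*z^2 + 2*x*y^2*z^2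
      + 10*x^2*z^3 + 8*y^2*z^3 - 4*x*z^4 - 2*z^5) :
    4096 * (z ^ 4 * linesProduct x y z) =
      (-6144*x*y^2 + 4840*x*z^2 + 273824*y^2*z - 204072*z^3) * (g₁ * g₁ * g₁)
        + (33500*x*z + 3424*y^2 + 30124*z^2) * (g₁ * g₁ * g₂)
        + (608*x^2 - 33548*x*z) * (g₁ * g₁ * g₃)
        + (-1536*x*y + 1792*y*z) * (g₁ * g₁ * g₄)
        + (20*z) * (g₁ * g₂ * g₂)
        + (844*z) * (g₁ * g₂ * g₃)
        + (-1024*y) * (g₁ * g₂ * g₄)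
        + (-880*z) * (g₁ * g₃ * g₃)
        + (-1) * (g₂ * g₂ * g₃)
        + (10) * (g₂ * g₃ * g₃)
        + (-128) * (g₂ * g₄ * g₄)
        + (-25) * (g₃ * g₃ * g₃)
        + (384) * (g₃ * g₄ * g₄) := by
  subst h₁ h₂ h₃ h₄
  unfold linesProduct
  ring

theorem linesProduct_mul_y_pow
    (h₁ : g₁ = 4*x^3*y - 4*x*y^3 - 3*x^2*y*z - 3*y^3*z - 2*x*y*z^2 + 2*y*z^3)
    (h₂ : g₂ = 32*y^5 + 88*x*y^3*z + 33*x^2*y*z^2 - 55*y^3*z^2 - 66*x*y*z^3 + 22*y*z^4)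
    (h₃ : g₃ = 32*x^2*y^3 + 72*x*y^3*z + 11*x^2*y*z^2 + 35*y^3*z^2 - 22*x*y*z^3 - 22*y*z^4) :
    32768 * (y ^ 4 * linesProduct x y z) =
      (-52096*x*y^2 - 64416*y^2*z) * (g₁ * g₁ * g₁)
        + (-1936*x^2 + 15972*z^2) * (g₁ * g₁ * g₂)
        + (5808*x^2 - 14762*z^2) * (g₁ * g₁ * g₃)
        + (-176*x - 484*z) * (g₁ * g₂ * g₂)
        + (-1804*x + 2871*z) * (g₁ * g₂ * g₃)
        + (572*x - 1023*z) * (g₁ * g₃ * g₃)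
        + (1) * (g₂ * g₂ * g₂)
        + (-77) * (g₂ * g₂ * g₃)
        + (55) * (g₂ * g₃ * g₃)
        + (-11) * (g₃ * g₃ * g₃) := by
  subst h₁ h₂ h₃
  unfold linesProduct
  ring

theorem linesProduct_mul_sq
    (h₁ : g₁ = 4*x^3*y - 4*x*y^3 - 3*x^2*y*z - 3*y^3*z - 2*x*y*z^2 + 2*y*z^3)
    (h₂ : g₂ = 32*y^5 + 88*x*y^3*z + 33*x^2*y*z^2 - 55*y^3*z^2 - 66*x*y*z^3 + 22*y*z^4)
    (h₃ : g₃ = 32*x^2*y^3 + 72*x*y^3*z + 11*x^2*y*z^2 + 35*y^3*z^2 - 22*x*y*z^3 - 22*y*z^4)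
    (h₄ : g₄ = 2*x^5 - 10*x*y^4 - 8*x^4*z - 15*x^2*y^2*z - 7*y^4*z + 4*x^3*z^2 + 2*x*y^2*z^2
      + 10*x^2*z^3 + 8*y^2*z^3 - 4*x*z^4 - 2*z^5) :
    3920 * ((2 * x ^ 2 - z ^ 2) ^ 2 * linesProduct x y z) =
      (38544*x^2*z - 46204*x*y^2 - 18501*y^2*z) * (g₁ * g₁ * g₁)
        + (-13360*x*z - 9352*z^2) * (g₁ * g₁ * g₂)
        + (15312*x*z + 12459*y^2) * (g₁ * g₁ * g₃)
        + (76440*x*y + 33162*y*z) * (g₁ * g₁ * g₄)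
        + (-1216*x - 836*z) * (g₁ * g₂ * g₃)
        + (532*z) * (g₁ * g₃ * g₃)
        + (-4374*y) * (g₁ * g₃ * g₄)
        + (-10780*x - 8085*z) * (g₁ * g₄ * g₄)
        + (-245) * (g₃ * g₄ * g₄) := by
  subst h₁ h₂ h₃ h₄
  unfold linesProduct
  ring

end Certificates

theorem mul_mem_cube {R : Type*} [CommRing R] {I : Ideal R} {f g h : R} (hf : f ∈ I) (hg : g ∈ I)
    (hh : h ∈ I) (c : R) : c * (f * g * h) ∈ I ^ 3 := by
  rw [pow_succ, sq]
  exact Ideal.mul_mem_left _ _ (Ideal.mul_mem_mul (Ideal.mul_mem_mul hf hg) hh)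

theorem mem_of_ofNat_mul_mem {I : Ideal (MvPolynomial (Fin 3) ℚ)} (n : ℕ) [n.AtLeastTwo]
    {f : MvPolynomial (Fin 3) ℚ} (h : OfNat.ofNat n * f ∈ I) : f ∈ I := by
  have hn : MvPolynomial.C (OfNat.ofNat n : ℚ)⁻¹ * (OfNat.ofNat n * f) = f := by
    rw [← mul_assoc, ← map_ofNat MvPolynomial.C n, ← map_mul,
      inv_mul_cancel₀ (OfNat.ofNat_ne_zero n), map_one, one_mul]
  exact hn ▸ Ideal.mul_mem_left _ _ h

theorem memSat_linesProduct : memSat (linesProduct x y z) := by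
  obtain ⟨g₁, hg₁⟩ : ∃ g, g =
    4*x^3*y - 4*x*y^3 - 3*x^2*y*z - 3*y^3*z - 2*x*y*z^2 + 2*y*z^3 := ⟨_, rfl⟩
  obtain ⟨g₂, hg₂⟩ : ∃ g, g =
    32*y^5 + 88*x*y^3*z + 33*x^2*y*z^2 - 55*y^3*z^2 - 66*x*y*z^3 + 22*y*z^4 := ⟨_, rfl⟩
  obtain ⟨g₃, hg₃⟩ : ∃ g, g =
    32*x^2*y^3 + 72*x*y^3*z + 11*x^2*y*z^2 + 35*y^3*z^2 - 22*x*y*z^3 - 22*y*z^4 := ⟨_, rfl⟩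
  obtain ⟨g₄, hg₄⟩ : ∃ g, g = 2*x^5 - 10*x*y^4 - 8*x^4*z - 15*x^2*y^2*z - 7*y^4*z + 4*x^3*z^2
    + 2*x*y^2*z^2 + 10*x^2*z^3 + 8*y^2*z^3 - 4*x*z^4 - 2*z^5 := ⟨_, rfl⟩
  have hI : I₁₁ = Ideal.span {g₁, g₂, g₃, g₄} := by rw [I₁₁, hg₁, hg₂, hg₃, hg₄]
  have h₁ : g₁ ∈ I₁₁ := hI ▸ Ideal.subset_span (by simp)
  have h₂ : g₂ ∈ I₁₁ := hI ▸ Ideal.subset_span (by simp)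
  have h₃ : g₃ ∈ I₁₁ := hI ▸ Ideal.subset_span (by simp)
  have h₄ : g₄ ∈ I₁₁ := hI ▸ Ideal.subset_span (by simp)
  let Q : Ideal (MvPolynomial (Fin 3) ℚ) := (I₁₁ ^ 3).colon {linesProduct x y z}
  have hQ : ∀ {r}, r * linesProduct x y z ∈ I₁₁ ^ 3 → r ∈ Q := fun h =>
    Submodule.mem_colon_singleton.mpr h
  have hz : z ∈ Q.radical := by
    refine ⟨4, hQ (mem_of_ofNat_mul_mem 4096 ?_)⟩
    rw [linesProduct_mul_z_pow x y z hg₁ hg₂ hg₃ hg₄]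
    repeat' first | apply mul_mem_cube <;> assumption | apply Ideal.add_mem
  have hy : y ∈ Q.radical := by
    refine ⟨4, hQ (mem_of_ofNat_mul_mem 32768 ?_)⟩
    rw [linesProduct_mul_y_pow x y z hg₁ hg₂ hg₃]
    repeat' first | apply mul_mem_cube <;> assumption | apply Ideal.add_mem
  have hxz : 2 * x ^ 2 - z ^ 2 ∈ Q.radical := by
    refine ⟨2, hQ (mem_of_ofNat_mul_mem 3920 ?_)⟩
    rw [linesProduct_mul_sq x y z hg₁ hg₂ hg₃ hg₄]
    repeat' first | apply mul_mem_cube <;> assumption | apply Ideal.add_mem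
  have hx : x ∈ Q.radical := by
    have h2 : 2 * x ^ 2 ∈ Q.radical := by
      have := Ideal.add_mem _ hxz (Ideal.mul_mem_left _ z hz)
      rwa [← sq, sub_add_cancel] at this
    exact Ideal.radical_idem Q ▸ ⟨2, mem_of_ofNat_mul_mem 2 h2⟩
  obtain ⟨k, hk⟩ := Ideal.exists_pow_le_of_le_radical_of_fg
    (I := Ideal.span {x, y, z}) (J := Q)
    (Ideal.span_le.mpr (by rintro f (rfl | rfl | rfl) <;> assumption))
    (IsNoetherian.noetherian _)
  refine ⟨k, Ideal.span_singleton_mul_le_iff.mpr fun r hr => ?_⟩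
  rw [mul_comm]
  exact Submodule.mem_colon_singleton.mp (hk hr)

/-- The initial degree of the third symbolic power `I₁₁⁽³⁾` (the saturation of `I₁₁³` with
respect to `⟨x,y,z⟩`) equals `11`: every nonzero homogeneous element of it has degree at
least `11`, and it contains a nonzero homogeneous element of degree exactly `11`. -/
theorem alpha_symbolic_cube_boroczky_11 :
    (∀ F : MvPolynomial (Fin 3) ℚ, ∀ d : ℕ, d < 11 → F.IsHomogeneous d → memSat F → F = 0) ∧
    (∃ F : MvPolynomial (Fin 3) ℚ, F ≠ 0 ∧ F.IsHomogeneous 11 ∧ memSat F) :=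
  ⟨fun _ _ hd hhom hF => eq_zero_of_memSat_of_lt hd hhom hF,
    linesProduct x y z, linesProduct_ne_zero, isHomogeneous_linesProduct, memSat_linesProduct⟩
end
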